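/- arXiv:math/0102106 — 3 statements merged into one kernel-verified Lean document; each statement's English description precedes it below -/
import Mathlib

section
/- Finite analog of Euler's formula: for every nonnegative integer L, ∑_{l=0}^{L} q^{2(T_L - T_l)} = ∑_{i,j,k ≥ 0} (-1)^j q^{2T_i + 2T_j + 2T_k - i - j} · C_{q²}(L-k, i) · C_{q²}(L-i, j) · C_{q²}(L-j, k), as polynomials in q. -/
open Finset

noncomputable def q : RatFunc ℚ := RatFunc.X

/-- Triangular number `T m = m(m+1)/2`. -/
def T (m : ℤ) : ℤ := m * (m + 1) / 2

/-- The Gaussian binomial coefficient in base `x`: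
`C_x(N, n) = (x^{N-n+1};x)_n / (x;x)_n` for `n ≥ 0`, and `0` when out of range
(`n < 0`; for `0 ≤ N < n` the product contains the factor `1 - x^0 = 0`). -/
noncomputable def qbinB (x : RatFunc ℚ) (N n : ℤ) : RatFunc ℚ :=
  if n < 0 then 0
  else ∏ r ∈ Finset.range n.toNat, (1 - x ^ (N - (r : ℤ))) / (1 - x ^ ((r : ℤ) + 1))

/-- Right-hand side of the finite Euler identity: the sum over all `i, j, k ≥ 0`;
terms with `i > L`, `j > L` or `k > L` vanish, so the ranges capture the full sum. -/
noncomputable def E (L : ℕ) : RatFunc ℚ :=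
  ∑ i ∈ Finset.range (L + 1), ∑ j ∈ Finset.range (L + 1), ∑ k ∈ Finset.range (L + 1),
    (-1) ^ j * q ^ (2 * T i + 2 * T j + 2 * T k - i - j) *
      qbinB (q ^ 2) ((L : ℤ) - k) i * qbinB (q ^ 2) ((L : ℤ) - i) j *
      qbinB (q ^ 2) ((L : ℤ) - j) k

/-- Left-hand side of the finite Euler identity. -/
noncomputable def F (L : ℕ) : RatFunc ℚ :=
  ∑ l ∈ Finset.range (L + 1), q ^ (2 * (T L - T l))

namespace FE

/-- the base `q^2` -/
noncomputable def x : RatFunc ℚ := q ^ 2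

lemma q_ne : q ≠ 0 := RatFunc.X_ne_zero

lemma x_ne : x ≠ 0 := pow_ne_zero _ q_ne

lemma x_pow_ne (n : ℕ) : (1 : RatFunc ℚ) - x ^ (n + 1) ≠ 0 := by
  intro h
  have h1 : (RatFunc.X : RatFunc ℚ) ^ (2 * (n + 1)) = 1 := by
    have := (sub_eq_zero.mp h).symm
    rw [x, q, ← pow_mul] at this
    exact this
  have h2 : algebraMap (Polynomial ℚ) (RatFunc ℚ) (Polynomial.X ^ (2 * (n + 1)))
      = algebraMap (Polynomial ℚ) (RatFunc ℚ) 1 := by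
    rw [map_pow, RatFunc.algebraMap_X, h1, map_one]
  have h3 := RatFunc.algebraMap_injective ℚ h2
  have h4 := congrArg Polynomial.natDegree h3
  simp at h4

/-- product form of the Gaussian binomial -/
noncomputable def P (N : ℤ) (n : ℕ) : RatFunc ℚ :=
  ∏ r ∈ range n, (1 - x ^ (N - (r : ℤ))) / (1 - x ^ ((r : ℤ) + 1))

lemma P_zero (N : ℤ) : P N 0 = 1 := by simp [P]

lemma den_ne (n : ℕ) : (1 : RatFunc ℚ) - x ^ ((n : ℤ) + 1) ≠ 0 := by
  have := x_pow_ne n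
  exact_mod_cast this

lemma P_succ (N : ℤ) (n : ℕ) :
    P N (n + 1) * (1 - x ^ ((n : ℤ) + 1)) = P N n * (1 - x ^ (N - (n : ℤ))) := by
  rw [P, prod_range_succ, ← P, mul_assoc, div_mul_cancel₀ _ (den_ne n)]

lemma P_succ' (N : ℤ) (n : ℕ) :
    P N (n + 1) * (1 - x ^ ((n : ℤ) + 1)) = P (N - 1) n * (1 - x ^ N) := by
  induction n generalizing N with
  | zero => rw [P_succ]; simp [P_zero]
  | succ n ih =>
    rw [P_succ]
    have h1 := ih N
    have h2 := P_succ (N - 1) n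
    have e : N - ((n + 1 : ℕ) : ℤ) = N - 1 - n := by push_cast; ring
    rw [e]
    apply mul_right_cancel₀ (den_ne n)
    linear_combination (1 - x ^ (N - 1 - (n:ℤ))) * h1 - (1 - x ^ N) * h2

lemma P_pascal (N : ℤ) (n : ℕ) :
    P N (n + 1) = x ^ (n + 1) * P (N - 1) (n + 1) + P (N - 1) n := by
  apply mul_right_cancel₀ (den_ne n)
  have h1 := P_succ' N n
  have h2 := P_succ (N - 1) n
  have e : x ^ (n + 1) * x ^ (N - 1 - (n : ℤ)) = x ^ N := by
    rw [← zpow_natCast, ← zpow_add₀ x_ne]; congr 1; push_cast; ring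
  have e2 : x ^ ((n : ℤ) + 1) = x ^ (n + 1) := by norm_cast
  rw [e2] at h1 h2 ⊢
  linear_combination h1 - x ^ (n + 1) * h2 + P (N - 1) n * e

lemma P_pascal' (N : ℤ) (n : ℕ) :
    P N (n + 1) = P (N - 1) (n + 1) + x ^ (N - 1 - (n : ℤ)) * P (N - 1) n := by
  apply mul_right_cancel₀ (den_ne n)
  have h1 := P_succ' N n
  have h2 := P_succ (N - 1) n
  have e : x ^ (n + 1) * x ^ (N - 1 - (n : ℤ)) = x ^ N := by
    rw [← zpow_natCast, ← zpow_add₀ x_ne]; congr 1; push_cast; ring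
  have e2 : x ^ ((n : ℤ) + 1) = x ^ (n + 1) := by norm_cast
  rw [e2] at h1 h2 ⊢
  linear_combination h1 - h2 + P (N - 1) n * e

lemma P_eq_zero (N n : ℕ) (h : N < n) : P N n = 0 := by
  rw [P]
  apply prod_eq_zero (mem_range.mpr h)
  simp

lemma P_self (n : ℕ) : P n n = 1 := by
  induction n with
  | zero => exact P_zero _
  | succ n ih =>
    rw [P_pascal, ((by push_cast; ring) : ((n + 1 : ℕ) : ℤ) - 1 = n), ih,
      P_eq_zero n (n + 1) (by omega)]
    simp

/-- Gaussian binomial, zero out of range. -/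
noncomputable def g (N : ℤ) (n : ℕ) : RatFunc ℚ := if N < 0 then 0 else P N n

lemma g_neg (N : ℤ) (n : ℕ) (h : N < 0) : g N n = 0 := by simp [g, h]

lemma g_nonneg (N : ℤ) (n : ℕ) (h : 0 ≤ N) : g N n = P N n := by simp [g, not_lt.mpr h]

lemma g_zero_of_lt (N : ℤ) (n : ℕ) (h : N < n) : g N n = 0 := by
  rcases lt_or_ge N 0 with h0 | h0
  · exact g_neg _ _ h0
  · rw [g_nonneg _ _ h0]
    lift N to ℕ using h0
    exact P_eq_zero N n (by exact_mod_cast h)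

lemma g_pascal (N : ℤ) (n : ℕ) :
    g N (n + 1) = x ^ (n + 1) * g (N - 1) (n + 1) + g (N - 1) n := by
  rcases lt_trichotomy N 0 with h | h | h
  · simp [g_neg _ _ h, g_neg (N - 1) _ (by omega)]
  · subst h
    rw [g_zero_of_lt 0 (n + 1) (by positivity), g_neg _ _ (by omega), g_neg _ _ (by omega)]
    simp
  · rw [g_nonneg _ _ h.le, g_nonneg _ _ (by omega), g_nonneg _ _ (by omega)]
    exact P_pascal N n

lemma g_pascal' (N : ℤ) (n : ℕ) :
    g N (n + 1) = g (N - 1) (n + 1) + x ^ (N - 1 - (n : ℤ)) * g (N - 1) n := by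
  rcases lt_trichotomy N 0 with h | h | h
  · simp [g_neg _ _ h, g_neg (N - 1) _ (by omega)]
  · subst h
    rw [g_zero_of_lt 0 (n + 1) (by positivity), g_neg _ _ (by omega), g_neg _ _ (by omega)]
    simp
  · rw [g_nonneg _ _ h.le, g_nonneg _ _ (by omega), g_nonneg _ _ (by omega)]
    exact P_pascal' N n

lemma g_zero (N : ℤ) : g N 0 = g (N - 1) 0 + if N = 0 then 1 else 0 := by
  rcases lt_trichotomy N 0 with h | h | h
  · simp [g_neg _ _ h, g_neg (N - 1) _ (by omega), h.ne]
  · subst h; simp [g, P_zero]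
  · rw [g_nonneg _ _ h.le, g_nonneg _ _ (by omega), P_zero, P_zero]; simp [h.ne']

/-- `x^{T_i}` -/
noncomputable def e (i : ℕ) : RatFunc ℚ := x ^ (i * (i + 1) / 2)

lemma e_succ (i : ℕ) : e (i + 1) = x ^ (i + 1) * e i := by
  rw [e, e, ← pow_add]
  congr 1
  have : (i + 1) * (i + 1 + 1) = i * (i + 1) + (i + 1) * 2 := by ring
  rw [this, Nat.add_mul_div_right _ _ (by norm_num)]
  ring

lemma e_zero : e 0 = 1 := by simp [e]

/-- the inner sum over `i`, first recurrence -/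
lemma inner_a (M : ℕ) (N : ℤ) (hN : N < M) (a : RatFunc ℚ) (f : ℤ → RatFunc ℚ) :
    ∑ i ∈ range M, a ^ i * e i * g N i * f i
      = ∑ i ∈ range M, (a * x) ^ i * e i * g (N - 1) i * f i
        + a * x * ∑ i ∈ range M, (a * x) ^ i * e i * g (N - 1) i * f (i + 1)
        + if N = 0 then f 0 else 0 := by
  rcases M with _ | M
  · have : N ≠ 0 := by simp at hN; omega
    simp [this]
  · rw [sum_range_succ', sum_range_succ' (fun i => (a * x) ^ i * e i * g (N - 1) i * f i),
      sum_range_succ (fun i => (a * x) ^ i * e i * g (N - 1) i * f (i + 1)),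
      g_zero_of_lt (N - 1) M (by push_cast at hN; omega), g_zero N]
    have : ∑ i ∈ range M, a ^ (i + 1) * e (i + 1) * g N (i + 1) * f ((i + 1 : ℕ) : ℤ)
      = ∑ i ∈ range M, (a * x) ^ (i + 1) * e (i + 1) * g (N - 1) (i + 1) * f ((i + 1 : ℕ) : ℤ)
        + a * x * ∑ i ∈ range M, (a * x) ^ i * e i * g (N - 1) i * f (i + 1) := by
      rw [mul_sum, ← sum_add_distrib]
      apply sum_congr rfl
      intro i _
      rw [g_pascal, e_succ]
      push_cast
      ring
    rw [this, e_zero]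
    split_ifs <;> simp <;> ring

lemma inner_b (M : ℕ) (N : ℤ) (hN : N < M) (a : RatFunc ℚ) (f : ℤ → RatFunc ℚ) :
    ∑ i ∈ range M, a ^ i * e i * g N i * f i
      = ∑ i ∈ range M, a ^ i * e i * g (N - 1) i * f i
        + a * x ^ N * ∑ i ∈ range M, a ^ i * e i * g (N - 1) i * f (i + 1)
        + if N = 0 then f 0 else 0 := by
  rcases M with _ | M
  · have : N ≠ 0 := by simp at hN; omega
    simp [this]
  · rw [sum_range_succ', sum_range_succ' (fun i => a ^ i * e i * g (N - 1) i * f i),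
      sum_range_succ (fun i => a ^ i * e i * g (N - 1) i * f (i + 1)),
      g_zero_of_lt (N - 1) M (by push_cast at hN; omega), g_zero N]
    have : ∑ i ∈ range M, a ^ (i + 1) * e (i + 1) * g N (i + 1) * f ((i + 1 : ℕ) : ℤ)
      = ∑ i ∈ range M, a ^ (i + 1) * e (i + 1) * g (N - 1) (i + 1) * f ((i + 1 : ℕ) : ℤ)
        + a * x ^ N * ∑ i ∈ range M, a ^ i * e i * g (N - 1) i * f (i + 1) := by
      rw [mul_sum, ← sum_add_distrib]
      apply sum_congr rfl
      intro i _
      have h : x ^ (i + 1) * x ^ (N - 1 - (i : ℤ)) = x ^ N := by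
        rw [← zpow_natCast, ← zpow_add₀ x_ne]; congr 1; push_cast; ring
      rw [g_pascal', e_succ, ← h]
      push_cast
      ring
    rw [this, e_zero]
    split_ifs <;> simp <;> ring

/-- The triple sum. -/
noncomputable def S (M : ℕ) (A B C : ℤ) (a b c : RatFunc ℚ) : RatFunc ℚ :=
  ∑ j ∈ range M, ∑ k ∈ range M, ∑ i ∈ range M,
    a ^ i * e i * g (A - k) i * ((b ^ j * e j * (c ^ k * e k) * g (C - j) k) * g (B - i) j)

/-- boundary term -/
noncomputable def D (M : ℕ) (A B C : ℤ) (b c : RatFunc ℚ) : RatFunc ℚ :=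
  ∑ j ∈ range M, ∑ k ∈ range M,
    if A - k = 0 then (b ^ j * e j * (c ^ k * e k) * g (C - j) k) * g (B - 0) j else 0

lemma S_rot (M : ℕ) (A B C : ℤ) (a b c : RatFunc ℚ) : S M A B C a b c = S M B C A b c a := by
  rw [S, S]
  -- left: j k i ; right: sum over (k, i, j)
  rw [sum_comm]
  refine sum_congr rfl fun k _ => ?_
  rw [sum_comm]
  refine sum_congr rfl fun i _ => ?_
  refine sum_congr rfl fun j _ => ?_
  ring

lemma S_a (M : ℕ) (A B C : ℤ) (hA : A < M) (a b c : RatFunc ℚ) :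
    S M A B C a b c = S M (A - 1) B C (a * x) b c
      + a * x * S M (A - 1) (B - 1) C (a * x) b c + D M A B C b c := by
  simp only [S, D, mul_sum, ← sum_add_distrib]
  refine sum_congr rfl fun j _ => ?_
  refine sum_congr rfl fun k _ => ?_
  have := inner_a M (A - k) (by omega) a
    (fun i => (b ^ j * e j * (c ^ k * e k) * g (C - j) k) * g (B - i) j)
  rw [this, mul_sum, sum_add_distrib]
  refine congrArg₂ _ (congrArg₂ _ ?_ ?_) rfl
  · refine sum_congr rfl fun i _ => ?_
    rw [sub_right_comm]
  · refine sum_congr rfl fun i _ => ?_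
    rw [sub_right_comm A, show B - ((i : ℤ) + 1) = B - 1 - i by ring]

lemma S_b (M : ℕ) (A B C : ℤ) (hA : A < M) (a b c : RatFunc ℚ) :
    S M A B C a b c = S M (A - 1) B C a b c
      + a * x ^ A * S M (A - 1) (B - 1) C a b (c / x) + D M A B C b c := by
  simp only [S, D, mul_sum, ← sum_add_distrib]
  refine sum_congr rfl fun j _ => ?_
  refine sum_congr rfl fun k _ => ?_
  have := inner_b M (A - k) (by omega) a
    (fun i => (b ^ j * e j * (c ^ k * e k) * g (C - j) k) * g (B - i) j)
  rw [this, mul_sum, sum_add_distrib]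
  refine congrArg₂ _ (congrArg₂ _ ?_ ?_) rfl
  · refine sum_congr rfl fun i _ => ?_
    rw [sub_right_comm]
  · refine sum_congr rfl fun i _ => ?_
    rw [sub_right_comm A, show B - ((i : ℤ) + 1) = B - 1 - i by ring, zpow_sub₀ x_ne, div_pow,
      zpow_natCast]
    ring

lemma D_zero (M : ℕ) (A B C : ℤ) (h : C < A) (b c : RatFunc ℚ) : D M A B C b c = 0 := by
  rw [D]
  refine sum_eq_zero fun j _ => sum_eq_zero fun k _ => ?_
  split_ifs with hk
  · rw [g_zero_of_lt (C - j) k (by omega)]; simp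
  · rfl

lemma D_eq (M n : ℕ) (B : ℤ) (h : n < M) (hB : 0 ≤ B) (b c : RatFunc ℚ) :
    D M n B n b c = c ^ n * e n := by
  rw [D, sum_eq_single_of_mem 0 (by simp; omega), sum_eq_single_of_mem n (by simpa using h)]
  · simp [e_zero, g_nonneg _ _ hB, P_zero, g_nonneg n n (by positivity), P_self]
  · intro k _ hk
    rw [if_neg]; omega
  · intro j _ hj
    refine sum_eq_zero fun k _ => ?_
    split_ifs with hk
    · rw [g_zero_of_lt _ k (by omega)]; simp
    · rfl

lemma S_a2 (M : ℕ) (A B C : ℤ) (hB : B < M) (a b c : RatFunc ℚ) :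
    S M A B C a b c = S M A (B - 1) C a (b * x) c
      + b * x * S M A (B - 1) (C - 1) a (b * x) c + D M B C A c a := by
  have := S_a M B C A hB b c a
  rwa [← S_rot M A B C, ← S_rot M A (B - 1) C, ← S_rot M A (B - 1) (C - 1)] at this

lemma S_b2 (M : ℕ) (A B C : ℤ) (hB : B < M) (a b c : RatFunc ℚ) :
    S M A B C a b c = S M A (B - 1) C a b c
      + b * x ^ B * S M A (B - 1) (C - 1) (a / x) b c + D M B C A c a := by
  have := S_b M B C A hB b c a
  rwa [← S_rot M A B C, ← S_rot M A (B - 1) C, ← S_rot M A (B - 1) (C - 1)] at this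

lemma S_a3 (M : ℕ) (A B C : ℤ) (hC : C < M) (a b c : RatFunc ℚ) :
    S M A B C a b c = S M A B (C - 1) a b (c * x)
      + c * x * S M (A - 1) B (C - 1) a b (c * x) + D M C A B a b := by
  have := S_a M C A B hC c a b
  rwa [S_rot M C A B, S_rot M (C - 1) A B, S_rot M (C - 1) (A - 1) B] at this

lemma S_b3 (M : ℕ) (A B C : ℤ) (hC : C < M) (a b c : RatFunc ℚ) :
    S M A B C a b c = S M A B (C - 1) a b c
      + c * x ^ C * S M (A - 1) B (C - 1) a (b / x) c + D M C A B a b := by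
  have := S_b M C A B hC c a b
  rwa [S_rot M C A B, S_rot M (C - 1) A B, S_rot M (C - 1) (A - 1) B] at this

/-- The key recurrence. -/
lemma S_rec (M n : ℕ) (h : n + 2 < M) (a : RatFunc ℚ) :
    S M (n + 2) (n + 2) (n + 2) a (-a) 1
      = (1 + x ^ (n + 2)) * S M (n + 1) (n + 1) (n + 1) a (-a) 1
        - a ^ 2 * x ^ (n + 2) * S M n n n a (-a) 1 := by
  have r1 := S_b3 M (n + 2) (n + 2) (n + 2) (by omega) a (-a) 1
  have r2 := S_b M (n + 2) (n + 2) (n + 1) (by omega) a (-a) 1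
  have r3 := S_b2 M (n + 1) (n + 2) (n + 1) (by omega) a (-a) 1
  have r4 := S_a2 M (n + 1) (n + 2) (n + 1) (by omega) a (-a / x) 1
  have r5 := S_a3 M (n + 1) (n + 1) (n + 1) (by omega) a (-a) (1 / x)
  have r6 := S_a M (n + 1) (n + 1) n (by omega) (a / x) (-a) 1
  rw [D_zero _ _ _ _ (by omega)] at r2 r3 r4 r6
  have d1 := D_eq M (n + 2) (n + 2) h (by positivity) a (-a)
  have d5 := D_eq M (n + 1) (n + 1) (by omega) (by positivity) a (-a)
  push_cast at d1 d5
  rw [d1] at r1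
  rw [d5] at r5
  have z : x ^ ((n : ℤ) + 2) = x ^ (n + 2) := by norm_cast
  rw [e_succ (n + 1)] at r1
  simp only [div_mul_cancel₀ _ x_ne, z, show (n : ℤ) + 2 - 1 = n + 1 by ring,
    show (n : ℤ) + 1 - 1 = n by ring] at r1 r2 r3 r4 r5 r6
  linear_combination r1 + r2 + r3 + x ^ (n + 2) * (r4 + a * r5 - a * r6)

lemma e_zpow (i : ℕ) : e i = q ^ (2 * T i) := by
  have : T i = ((i * (i + 1) / 2 : ℕ) : ℤ) := by rw [T]; push_cast; rfl
  rw [this, e, x, ← pow_mul]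
  norm_cast

lemma qbin_eq (N : ℤ) (n : ℕ) (h : 0 ≤ N) : qbinB (q ^ 2) N n = g N n := by
  rw [g_nonneg _ _ h, qbinB, if_neg (by omega), P]
  rfl

lemma E_eq_S (L : ℕ) : E L = S (L + 1) L L L q⁻¹ (-q⁻¹) 1 := by
  rw [S_rot, S_rot, E, S]
  refine sum_congr rfl fun i hi => sum_congr rfl fun j hj => sum_congr rfl fun k hk => ?_
  rw [mem_range] at hi hj hk
  rw [qbin_eq _ _ (by omega), qbin_eq _ _ (by omega), qbin_eq _ _ (by omega),
    zpow_sub₀ q_ne, zpow_sub₀ q_ne, zpow_add₀ q_ne, zpow_add₀ q_ne, ← e_zpow, ← e_zpow, ← e_zpow,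
    neg_pow q⁻¹, zpow_natCast, zpow_natCast, one_pow, inv_pow, inv_pow]
  ring

lemma S_indep (M L : ℕ) (h : L < M) (a b c : RatFunc ℚ) :
    S M L L L a b c = S (L + 1) L L L a b c := by
  have hs : range (L + 1) ⊆ range M := by
    intro i; simp only [mem_range]; omega
  symm
  rw [S, S]
  refine (sum_congr rfl fun j _ => ?_).trans (sum_subset hs fun j _ hj => ?_)
  · refine (sum_congr rfl fun k _ => ?_).trans (sum_subset hs fun k _ hk => ?_)
    · refine sum_subset hs fun i _ hi => ?_
      rw [mem_range] at hi
      rw [g_zero_of_lt _ i (by omega)]; simp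
    · rw [mem_range] at hk
      rw [g_zero_of_lt _ k (by omega)]; simp
  · rw [mem_range] at hj
    refine sum_eq_zero fun k _ => sum_eq_zero fun i _ => ?_
    rw [g_zero_of_lt _ j (by omega)]; simp

lemma E_rec (n : ℕ) :
    E (n + 2) = (1 + x ^ (n + 2)) * E (n + 1) - x ^ (n + 1) * E n := by
  have h := S_rec (n + 3) n (by omega) q⁻¹
  have h1 := S_indep (n + 3) (n + 1) (by omega) q⁻¹ (-q⁻¹) 1
  have h0 := S_indep (n + 3) n (by omega) q⁻¹ (-q⁻¹) 1
  rw [E_eq_S, E_eq_S, E_eq_S, ← h1, ← h0]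
  push_cast
  rw [h]
  have : q⁻¹ ^ 2 * x ^ (n + 2) = x ^ (n + 1) := by
    rw [pow_succ x (n + 1), inv_pow, ← x]
    field_simp [x_ne]
  rw [this]

lemma F_succ (n : ℕ) : F (n + 1) = x ^ (n + 1) * F n + 1 := by
  rw [F, sum_range_succ, F, mul_sum]
  congr 1
  · refine sum_congr rfl fun l _ => ?_
    rw [mul_sub, mul_sub, zpow_sub₀ q_ne, zpow_sub₀ q_ne, ← e_zpow, ← e_zpow, ← e_zpow, e_succ]
    ring
  · simp

lemma E_zero : E 0 = 1 := by
  simp [E, qbinB, T]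

lemma E_one : E 1 = x + 1 := by
  have hx : (1 : RatFunc ℚ) - q ^ 2 ≠ 0 := by simpa [x] using x_pow_ne 0
  simp [E, qbinB, T, sum_range_succ, hx]
  rw [x, add_comm]

lemma F_zero : F 0 = 1 := by simp [F, T]

theorem main (L : ℕ) : F L = E L ∧ F (L + 1) = E (L + 1) := by
  induction L with
  | zero =>
    refine ⟨by rw [F_zero, E_zero], ?_⟩
    rw [F_succ, F_zero, E_one]; ring
  | succ n ih =>
    refine ⟨ih.2, ?_⟩
    have h1 := F_succ n
    have h2 := F_succ (n + 1)
    rw [E_rec, ← ih.1, ← ih.2, h2]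
    linear_combination -h1

end FE

/-- Finite analog of the Euler formula. -/
theorem finite_euler (L : ℕ) : F L = E L := (FE.main L).1
end

section
/- Double bounded polynomial key identity: for integers i, j, k, L, M, the sum over nonnegative integers a, b, c, ab, ac, bc with i = a+ab+ac, j = b+ab+bc, k = c+ac+bc, of q^{T_t + T_{ab} + T_{ac} + T_{bc-1}} times { q^{bc} · C(L-t+a, a) C(L-t+b, b) C(M-t+c, c) C(L-t, ab) C(M-t, ac) C(M-t, bc) + C(L-t+a-1, a-1) C(L-t+b, b) C(M-t+c, c) C(L-t, ab) C(M-t, ac) C(M-t, bc-1) }, equals ∑_{s≥0} q^{s(M+2) - T_s + T_{i-s} + T_{j-s} + T_{k-s}} · C(L-s over s, i-s, j-s) · C(M-i-j, k-s), where t = a+b+c+ab+ac+bc, C denotes the q-binomial coefficient, and the q-multinomial C(L-s over s, i-s, j-s) = C(L-s, s)·C(L-2s, i-s)·C(L-s-i, j-s). -/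
open Finset

/-- The Gaussian binomial coefficient `C(N, n) = (q^{N-n+1};q)_n / (q;q)_n` for
`n ≥ 0`, and `0` when out of range (`n < 0`).  For `0 ≤ N < n` the product
contains the factor `1 - q^0 = 0`, so it vanishes. -/
noncomputable def qbin (N n : ℤ) : RatFunc ℚ :=
  if n < 0 then 0
  else ∏ r ∈ Finset.range n.toNat, (1 - q ^ (N - (r : ℤ))) / (1 - q ^ ((r : ℤ) + 1))


/-- The sum `g_{i,j,k}(L1,L2,M)` of Theorem 5 of Berkovich–Riese: the sum over
nonnegative integers `a, b, c, ab, ac, bc` with `i = a+ab+ac`, `j = b+ab+bc`,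
`k = c+ac+bc` (summation variables `ab, ac, bc`; `a, b, c` are determined). -/
noncomputable def g (i j k L1 L2 M : ℤ) : RatFunc ℚ :=
  ∑ ab ∈ Finset.range (i.toNat + 1), ∑ ac ∈ Finset.range (i.toNat + 1),
    ∑ bc ∈ Finset.range (j.toNat + 1),
      if (ab : ℤ) + ac ≤ i ∧ (ab : ℤ) + bc ≤ j ∧ (ac : ℤ) + bc ≤ k then
        (let a : ℤ := i - ab - ac
         let b : ℤ := j - ab - bc
         let c : ℤ := k - ac - bc
         let t : ℤ := a + b + c + ab + ac + bc
         q ^ (T t + T ab + T ac + T ((bc : ℤ) - 1)) *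
           (q ^ (bc : ℤ) * qbin (L1 - t + a) a * qbin (L2 - t + b) b * qbin (L2 - t) ab *
               qbin (M - t + c) c * qbin (M - t) ac * qbin (M - t) bc +
             qbin (L1 - t + a - 1) (a - 1) * qbin (L2 - t + b) b * qbin (L2 - t) ab *
               qbin (M - t + c) c * qbin (M - t) ac * qbin (M - t) ((bc : ℤ) - 1)))
      else 0


lemma q_ne_zero : q ≠ 0 := RatFunc.X_ne_zero

lemma q_pow_ne_one (n : ℕ) : q ^ (n + 1) ≠ 1 := by
  intro h
  have h2 : (algebraMap (Polynomial ℚ) (RatFunc ℚ)) (Polynomial.X ^ (n + 1))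
      = algebraMap (Polynomial ℚ) (RatFunc ℚ) 1 := by
    rw [map_pow, map_one, RatFunc.algebraMap_X]
    exact h
  have h3 := RatFunc.algebraMap_injective ℚ h2
  have h4 := congrArg Polynomial.natDegree h3
  simp at h4

lemma one_sub_q_ne (n : ℤ) (hn : 0 < n) : 1 - q ^ n ≠ 0 := by
  intro h
  obtain ⟨m, rfl⟩ : ∃ m : ℕ, n = (m : ℤ) + 1 := ⟨(n - 1).toNat, by omega⟩
  apply q_pow_ne_one m
  have h2 : q ^ ((m : ℤ) + 1) = q ^ (m + 1) := by
    rw [← zpow_natCast]; push_cast; rfl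
  rw [← h2]
  exact (sub_eq_zero.mp h).symm

lemma qbin_neg (N n : ℤ) (h : n < 0) : qbin N n = 0 := by simp [qbin, h]

lemma qbin_zero (N : ℤ) : qbin N 0 = 1 := by simp [qbin]

lemma nonneg_of_qbin {N n : ℤ} (h : qbin N n ≠ 0) : 0 ≤ n := by
  by_contra h2
  exact h (qbin_neg N n (by omega))

/-- `(1-q^n) C(N,n) = (1-q^(N-n+1)) C(N,n-1)`. -/
lemma qbin_down (N n : ℤ) : (1 - q ^ n) * qbin N n = (1 - q ^ (N - n + 1)) * qbin N (n - 1) := by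
  rcases lt_trichotomy n 0 with h | h | h
  · rw [qbin_neg N n h, qbin_neg N (n - 1) (by omega)]; simp
  · subst h; rw [qbin_neg N (0 - 1) (by omega)]; simp
  · obtain ⟨m, rfl⟩ : ∃ m : ℕ, n = (m : ℤ) + 1 := ⟨(n - 1).toNat, by omega⟩
    have h1 := one_sub_q_ne _ h
    have e1 : ((m : ℤ) + 1).toNat = m + 1 := by omega
    have e2 : ((m : ℤ) + 1 - 1).toNat = m := by omega
    have e3 : N - ((m : ℤ) + 1) + 1 = N - m := by ring
    simp only [qbin, e1, e2, e3, if_neg (show ¬ ((m : ℤ) + 1 < 0) by omega),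
      if_neg (show ¬ ((m : ℤ) + 1 - 1 < 0) by omega), Finset.prod_range_succ]
    field_simp

/-- `(1-q^(N-n)) C(N,n) = (1-q^N) C(N-1,n)`. -/
lemma qbin_left (N n : ℤ) : (1 - q ^ (N - n)) * qbin N n = (1 - q ^ N) * qbin (N - 1) n := by
  rcases lt_or_ge n 0 with h | h
  · rw [qbin_neg N n h, qbin_neg (N - 1) n h]; simp
  · obtain ⟨m, rfl⟩ := Int.eq_ofNat_of_zero_le h
    clear h
    induction m with
    | zero => simp [qbin_zero]
    | succ m ih =>
      have h1 := one_sub_q_ne ((m : ℤ) + 1) (by omega)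
      have d1 := qbin_down N ((m : ℤ) + 1)
      have d2 := qbin_down (N - 1) ((m : ℤ) + 1)
      rw [show (m : ℤ) + 1 - 1 = m by ring, show N - ((m : ℤ) + 1) + 1 = N - m by ring] at d1
      rw [show (m : ℤ) + 1 - 1 = m by ring, show N - 1 - ((m : ℤ) + 1) + 1 = N - (m + 1) by ring] at d2
      push_cast
      apply mul_left_cancel₀ h1
      linear_combination (1 - q ^ (N - ((m : ℤ) + 1))) * d1 + (1 - q ^ (N - ((m : ℤ) + 1))) * ih
        - (1 - q ^ N) * d2

/-- `(1-q^n) C(N,n) = (1-q^N) C(N-1,n-1)`. -/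
lemma qbin_absorb (N n : ℤ) : (1 - q ^ n) * qbin N n = (1 - q ^ N) * qbin (N - 1) (n - 1) := by
  rw [qbin_down]
  have := qbin_left N (n - 1)
  rwa [show N - (n - 1) = N - n + 1 by ring] at this

lemma pascal1 (N n : ℤ) : qbin (N + 1) n = qbin N (n - 1) + q ^ n * qbin N n := by
  rcases lt_trichotomy n 0 with h | h | h
  · rw [qbin_neg _ n h, qbin_neg _ n h, qbin_neg N (n - 1) (by omega)]; simp
  · subst h; rw [qbin_neg N (0 - 1) (by omega)]; simp [qbin_zero]
  · have h1 := one_sub_q_ne _ h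
    have d1 := qbin_absorb (N + 1) n
    have d2 := qbin_down N n
    rw [show N + 1 - 1 = N by ring] at d1
    have e : q ^ (N + 1) = q ^ n * q ^ (N - n + 1) := by
      rw [← zpow_add₀ q_ne_zero]; congr 1; ring
    apply mul_left_cancel₀ h1
    linear_combination d1 - q ^ n * d2 - qbin N (n - 1) * e

lemma pascal2 (N n : ℤ) :
    qbin (N + 1) n = qbin N n + q ^ (N + 1 - n) * qbin N (n - 1) := by
  have d := qbin_down N n
  rw [show N - n + 1 = N + 1 - n by ring] at d
  rw [pascal1]
  linear_combination -d

lemma T_cast (m : ℤ) : ((T m : ℤ) : ℚ) = (m : ℚ) * (m + 1) / 2 := by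
  have h : 2 ∣ m * (m + 1) := (Int.even_mul_succ_self m).two_dvd
  unfold T
  rw [Int.cast_div h (by norm_num)]
  push_cast
  rfl

/-- product of a power of `q` and six Gaussian coefficients -/
noncomputable def H (e n1 m1 n2 m2 n3 m3 n4 m4 n5 m5 n6 m6 : ℤ) : RatFunc ℚ :=
  q ^ e * qbin n1 m1 * qbin n2 m2 * qbin n3 m3 * qbin n4 m4 * qbin n5 m5 * qbin n6 m6

lemma H_congr {e n1 m1 n2 m2 n3 m3 n4 m4 n5 m5 n6 m6 : ℤ}
    {e' n1' m1' n2' m2' n3' m3' n4' m4' n5' m5' n6' m6' : ℤ}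
    (he : (e : ℚ) = e') (h1 : n1 = n1') (g1 : m1 = m1') (h2 : n2 = n2') (g2 : m2 = m2')
    (h3 : n3 = n3') (g3 : m3 = m3') (h4 : n4 = n4') (g4 : m4 = m4') (h5 : n5 = n5') (g5 : m5 = m5')
    (h6 : n6 = n6') (g6 : m6 = m6') :
    H e n1 m1 n2 m2 n3 m3 n4 m4 n5 m5 n6 m6
      = q ^ e' * qbin n1' m1' * qbin n2' m2' * qbin n3' m3' * qbin n4' m4' * qbin n5' m5'
        * qbin n6' m6' := by
  have he := Int.cast_injective he
  subst he h1 g1 h2 g2 h3 g3 h4 g4 h5 g5 h6 g6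
  rfl

lemma H_supp {e n1 m1 n2 m2 n3 m3 n4 m4 n5 m5 n6 m6 : ℤ}
    (h : H e n1 m1 n2 m2 n3 m3 n4 m4 n5 m5 n6 m6 ≠ 0) :
    0 ≤ m1 ∧ 0 ≤ m2 ∧ 0 ≤ m3 ∧ 0 ≤ m4 ∧ 0 ≤ m5 ∧ 0 ≤ m6 := by
  simp only [H, mul_ne_zero_iff] at h
  obtain ⟨⟨⟨⟨⟨⟨_, h1⟩, h2⟩, h3⟩, h4⟩, h5⟩, h6⟩ := h
  exact ⟨nonneg_of_qbin h1, nonneg_of_qbin h2, nonneg_of_qbin h3, nonneg_of_qbin h4,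
    nonneg_of_qbin h5, nonneg_of_qbin h6⟩

/-- first part of the summand of `g` -/
noncomputable def pP (i j k L M x y z : ℤ) : RatFunc ℚ :=
  H (T (i + j + k - x - y - z) + T x + T y + T z)
    (L - (i + j + k - x - y - z) + (i - x - y)) (i - x - y)
    (L - (i + j + k - x - y - z) + (j - x - z)) (j - x - z)
    (L - (i + j + k - x - y - z)) x
    (M - (i + j + k - x - y - z) + (k - y - z)) (k - y - z)
    (M - (i + j + k - x - y - z)) y
    (M - (i + j + k - x - y - z)) z

/-- second part of the summand of `g` -/
noncomputable def pQ (i j k L M x y z : ℤ) : RatFunc ℚ :=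
  H (T (i + j + k - x - y - z) + T x + T y + T (z - 1))
    (L - (i + j + k - x - y - z) + (i - x - y) - 1) (i - x - y - 1)
    (L - (i + j + k - x - y - z) + (j - x - z)) (j - x - z)
    (L - (i + j + k - x - y - z)) x
    (M - (i + j + k - x - y - z) + (k - y - z)) (k - y - z)
    (M - (i + j + k - x - y - z)) y
    (M - (i + j + k - x - y - z)) (z - 1)

noncomputable def pD (i j k L M x y z : ℤ) : RatFunc ℚ :=
  q ^ i * (1 - q ^ (j - x - z)) * pP (i - 1) j k (L - 1) M x y z

noncomputable def pThird (i j k L M x y z : ℤ) : RatFunc ℚ :=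
  H (T (i + j + k - x - y - z) + T x + T y + T z + (i - x - y))
    (L - (i + j + k - x - y - z) + (i - x - y) - 1) (i - x - y)
    (L - (i + j + k - x - y - z) + (j - x - z)) (j - x - z)
    (L - (i + j + k - x - y - z)) x
    (M - (i + j + k - x - y - z) + (k - y - z)) (k - y - z)
    (M - (i + j + k - x - y - z)) (y - 1)
    (M - (i + j + k - x - y - z)) z

noncomputable def pX (i j k L M x y z : ℤ) : RatFunc ℚ :=
  H (T (i + j + k - x - y - z) + T x + T y + T z - (k - y - z) - z)
    (L - (i + j + k - x - y - z) + (i - x - y) - 1) (i - x - y - 1)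
    (L - (i + j + k - x - y - z) + (j - x - z)) (j - x - z)
    (L - (i + j + k - x - y - z)) x
    (M - (i + j + k - x - y - z) + (k - y - z)) (k - y - z - 1)
    (M - (i + j + k - x - y - z) + 1) y
    (M - (i + j + k - x - y - z) + 1) z

noncomputable def pR (i j k L M x y z : ℤ) : RatFunc ℚ :=
  H (T (i + j + k - x - y - z) + T x + T y + T z - z + i)
    (L - (i + j + k - x - y - z) + (i - x - y) - 2) (i - x - y - 1)
    (L - (i + j + k - x - y - z) + (j - x - z)) (j - x - z)
    (L - (i + j + k - x - y - z)) x
    (M - (i + j + k - x - y - z) + (k - y - z)) (k - y - z)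
    (M - (i + j + k - x - y - z)) y
    (M - (i + j + k - x - y - z)) (z - 1)

lemma algP {K : Type*} [CommRing K] (W qa qb qc qx qy qz qA qY u0 u1 u2 v v1 X0 X1 Y0 Y1 Y2 Z0 Z1 Z2 c0 c1 c2
    qq : K)
    (hu : u0 = u2 + qa * u1) (hu' : u0 = u1 + qA * u2)
    (hv : (1 - qb * qq) * v1 = (1 - qA) * v) (hX : (1 - qx) * X0 = (1 - qA) * X1)
    (hY : Y2 = Y1 + qy * Y0) (hY' : Y2 = Y0 + qY * Y1)
    (hZ : Z2 = Z1 + qz * Z0) (hc : c2 = c1 + qc * c0) :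
    (W * qb * qc * qz) * u0 * v * X0 * c0 * Y0 * Z0
     + (W * qb * qc * qz * qY) * u0 * v * X0 * c0 * Y1 * Z0
     - (qa * qx * qy) * ((W * qb * qc * qz) * u0 * v * X0 * c0 * Y0 * Z0)
     + (W * qb * qc * qz * (qa * qx * qy) * qA) * u2 * v * X0 * c0 * Y0 * Z0
     - W * u2 * v * X0 * c2 * Y2 * Z2
    = (1 - qb * qq) * ((W * qb * qc * qz * qa * qy) * u1 * v1 * X1 * c0 * Y0 * Z0)
      - (1 - qb) * (W * u2 * v * X0 * c2 * Y2 * Z2)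
      + (W * qb * qc * qz * qa) * u1 * v * X0 * c0 * Y1 * Z0
      - (W * qb * qz) * u2 * v * X0 * c1 * Y2 * Z0
      - (W * qb) * u2 * v * X0 * c2 * Y2 * Z1 := by
  have e1 : u1 + qA * u2 = u2 + qa * u1 := by rw [← hu, hu']
  have e2 : Y0 + qY * Y1 = Y1 + qy * Y0 := by rw [← hY, hY']
  subst hu hY hZ hc
  linear_combination (W * qb * qc * qz * (u2 + qa * u1) * v * X0 * c0 * Z0) * e2
    + (W * qb * qc * qz * qa * qx * qy * v * X0 * c0 * Y0 * Z0) * e1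
    - (W * qb * qc * qz * qa * qy * u1 * X1 * c0 * Y0 * Z0) * hv
    + (W * qb * qc * qz * qa * qy * u1 * v * c0 * Y0 * Z0) * hX

lemma algQ {K : Type*} [CommRing K] (W qc qi qA qY u2 u3 u4 v X0 Y0 Y1 Y2 Z1 Z2 Z0 qz c0 c1 c2 : K)
    (hu : u2 = u3 + qA * u4)
    (hY' : Y2 = Y0 + qY * Y1) (hZ : Z2 = Z1 + qz * Z0)
    (hc : c2 = c1 + qc * c0) :
    (W * qc) * u2 * v * X0 * c0 * Y0 * Z1
     + (W * qc * qY) * u2 * v * X0 * c0 * Y1 * Z1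
     - qi * ((W * qc) * u2 * v * X0 * c0 * Y0 * Z1)
     + (W * qc * qi * qA) * u4 * v * X0 * c0 * Y0 * Z1
    = W * u2 * v * X0 * c2 * Y2 * Z1 - (W * u2 * v * X0 * c1 * Y2 * Z2
        - (W * qz) * u2 * v * X0 * c1 * Y2 * Z0)
      - (W * qc * qi) * u3 * v * X0 * c0 * Y0 * Z1 := by
  subst hu hY' hZ hc
  ring

lemma algT {K : Type*} [CommRing K] (W qb qx qA u v v1 v2 X0 X1 X2 Y Z c : K)
    (hv : v = v1 + qb * v2) (hX : X0 = X1 + qx * X2)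
    (hX' : (1 - qx) * X0 = (1 - qA) * X1) (hv' : (1 - qb) * v2 = (1 - qA) * v1) :
    W * u * v * X0 * c * Y * Z - (W * qb * qx) * u * v2 * X2 * c * Y * Z
     = (W * qx) * u * v1 * X0 * c * Y * Z + W * u * v2 * X1 * c * Y * Z := by
  subst hv
  linear_combination (W * qb * u * v2 * c * Y * Z) * hX
    + (W * u * v1 * c * Y * Z) * hX' - (W * u * X1 * c * Y * Z) * hv'

lemma zmul (e f : ℤ) : q ^ e * q ^ f = q ^ (e + f) := (zpow_add₀ q_ne_zero e f).symm

lemma q_mul_H (f e n1 m1 n2 m2 n3 m3 n4 m4 n5 m5 n6 m6 : ℤ) :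
    q ^ f * H e n1 m1 n2 m2 n3 m3 n4 m4 n5 m5 n6 m6 = H (f + e) n1 m1 n2 m2 n3 m3 n4 m4 n5 m5 n6 m6 := by
  simp only [H, ← zmul]; ring

lemma id_point (a b c x y z A B i j k L M : ℤ) (hi : i = a + x + y) (hj : j = b + x + z)
    (hk : k = c + y + z) (hL : L = A + (a + b + c + x + y + z)) (hM : M = B + (a + b + c + x + y + z)) :
    (pP i j k L M x y z + pQ i j k L M x y z)
    + q ^ (M + 1) * (pP (i - 1) j (k - 1) (L - 1) (M - 1) x (y - 1) z
        + pQ (i - 1) j (k - 1) (L - 1) (M - 1) x (y - 1) z)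
    - q ^ i * (pP i j k L M x y z + pQ i j k L M x y z)
    + q ^ (i + L) * (pP (i - 1) j k (L - 1) (M - 1) x y z + pQ (i - 1) j k (L - 1) (M - 1) x y z)
    - q ^ i * pP (i - 1) j k (L - 1) M x y z
    = pD i j k L M (x - 1) y z - pD i j k L M x y z + pThird i j k L M x y z - pX i j k L M x y z
      - pR i j k L M x y z := by
  subst hi hj hk hL hM
  set w : ℤ := T (a + b + c + x + y + z) + T x + T y + T z with hw
  have hwq : (w : ℚ) = (a + b + c + x + y + z) * (a + b + c + x + y + z + 1) / 2 + x * (x + 1) / 2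
      + y * (y + 1) / 2 + z * (z + 1) / 2 := by
    rw [hw]; push_cast [T_cast]; ring
  have t1 : pP (a + x + y) (b + x + z) (c + y + z) (A + (a + b + c + x + y + z))
      (B + (a + b + c + x + y + z)) x y z
      = q ^ (w - b - c - z + b + c + z) * qbin (A + a) a * qbin (A + b) b * qbin A x * qbin (B + c) c
        * qbin B y * qbin B z := by
    unfold pP
    apply H_congr <;> (push_cast [T_cast, hwq]; ring)
  have t2 : q ^ (B + (a + b + c + x + y + z) + 1) *
      pP (a + x + y - 1) (b + x + z) (c + y + z - 1) (A + (a + b + c + x + y + z) - 1)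
      (B + (a + b + c + x + y + z) - 1) x (y - 1) z
      = q ^ (w - b - c - z + b + c + z + (B + 1 - y)) * qbin (A + a) a * qbin (A + b) b * qbin A x
        * qbin (B + c) c * qbin B (y - 1) * qbin B z := by
    unfold pP
    rw [q_mul_H]
    apply H_congr <;> (push_cast [T_cast, hwq]; ring)
  have t3 : q ^ (a + x + y + (A + (a + b + c + x + y + z))) *
      pP (a + x + y - 1) (b + x + z) (c + y + z) (A + (a + b + c + x + y + z) - 1)
      (B + (a + b + c + x + y + z) - 1) x y z
      = q ^ (w - b - c - z + b + c + z + (a + x + y) + A) * qbin (A + a - 1) (a - 1)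
        * qbin (A + b) b * qbin A x
        * qbin (B + c) c * qbin B y * qbin B z := by
    unfold pP
    rw [q_mul_H]
    apply H_congr <;> (push_cast [T_cast, hwq]; ring)
  have t4 : q ^ (a + x + y) *
      pP (a + x + y - 1) (b + x + z) (c + y + z) (A + (a + b + c + x + y + z) - 1)
      (B + (a + b + c + x + y + z)) x y z
      = q ^ (w - b - c - z) * qbin (A + a - 1) (a - 1)
        * qbin (A + b) b * qbin A x
        * qbin (B + c + 1) c * qbin (B + 1) y * qbin (B + 1) z := by
    unfold pP
    rw [q_mul_H]
    apply H_congr <;> (push_cast [T_cast, hwq]; ring)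
  have t5 : q ^ (a + x + y) *
      pP (a + x + y - 1) (b + x + z) (c + y + z) (A + (a + b + c + x + y + z) - 1)
      (B + (a + b + c + x + y + z)) (x - 1) y z
      = q ^ (w - b - c - z + b + c + z + a + y) * qbin (A + a - 1) a
        * qbin (A + b) (b + 1) * qbin (A - 1) (x - 1)
        * qbin (B + c) c * qbin B y * qbin B z := by
    unfold pP
    rw [q_mul_H]
    apply H_congr <;> (push_cast [T_cast, hwq]; ring)
  have t6 : pThird (a + x + y) (b + x + z) (c + y + z) (A + (a + b + c + x + y + z))
      (B + (a + b + c + x + y + z)) x y z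
      = q ^ (w - b - c - z + b + c + z + a) * qbin (A + a - 1) a * qbin (A + b) b * qbin A x
        * qbin (B + c) c * qbin B (y - 1) * qbin B z := by
    unfold pThird
    apply H_congr <;> (push_cast [T_cast, hwq]; ring)
  have t7 : pX (a + x + y) (b + x + z) (c + y + z) (A + (a + b + c + x + y + z))
      (B + (a + b + c + x + y + z)) x y z
      = q ^ (w - b - c - z + b) * qbin (A + a - 1) (a - 1) * qbin (A + b) b * qbin A x
        * qbin (B + c) (c - 1) * qbin (B + 1) y * qbin (B + 1) z := by
    unfold pX
    apply H_congr <;> (push_cast [T_cast, hwq]; ring)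
  have t8 : pR (a + x + y) (b + x + z) (c + y + z) (A + (a + b + c + x + y + z))
      (B + (a + b + c + x + y + z)) x y z
      = q ^ (w - b - c - z + b + c + (a + x + y)) * qbin (A + a - 2) (a - 1) * qbin (A + b) b
        * qbin A x
        * qbin (B + c) c * qbin B y * qbin B (z - 1) := by
    unfold pR
    apply H_congr <;> (push_cast [T_cast, hwq]; ring)
  have s1 : pQ (a + x + y) (b + x + z) (c + y + z) (A + (a + b + c + x + y + z))
      (B + (a + b + c + x + y + z)) x y z
      = q ^ (w - b - c - z + b + c) * qbin (A + a - 1) (a - 1) * qbin (A + b) b * qbin A x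
        * qbin (B + c) c
        * qbin B y * qbin B (z - 1) := by
    unfold pQ
    apply H_congr <;> (push_cast [T_cast, hwq]; ring)
  have s2 : q ^ (B + (a + b + c + x + y + z) + 1) *
      pQ (a + x + y - 1) (b + x + z) (c + y + z - 1) (A + (a + b + c + x + y + z) - 1)
      (B + (a + b + c + x + y + z) - 1) x (y - 1) z
      = q ^ (w - b - c - z + b + c + (B + 1 - y)) * qbin (A + a - 1) (a - 1) * qbin (A + b) b
        * qbin A x
        * qbin (B + c) c * qbin B (y - 1) * qbin B (z - 1) := by
    unfold pQ
    rw [q_mul_H]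
    apply H_congr <;> (push_cast [T_cast, hwq]; ring)
  have s3 : q ^ (a + x + y + (A + (a + b + c + x + y + z))) *
      pQ (a + x + y - 1) (b + x + z) (c + y + z) (A + (a + b + c + x + y + z) - 1)
      (B + (a + b + c + x + y + z) - 1) x y z
      = q ^ (w - b - c - z + b + c + (a + x + y) + A) * qbin (A + a - 2) (a - 2)
        * qbin (A + b) b * qbin A x
        * qbin (B + c) c * qbin B y * qbin B (z - 1) := by
    unfold pQ
    rw [q_mul_H]
    apply H_congr <;> (push_cast [T_cast, hwq]; ring)
  -- Pascal relations
  have hu := pascal1 (A + a - 1) a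
  have hu' := pascal2 (A + a - 1) a
  rw [show A + a - 1 + 1 = A + a by ring] at hu hu'
  rw [show A + a - a = A by ring] at hu'
  have hu3 := pascal2 (A + a - 2) (a - 1)
  rw [show A + a - 2 + 1 = A + a - 1 by ring, show A + a - 1 - (a - 1) = A by ring,
    show a - 1 - 1 = a - 2 by ring] at hu3
  have hv := qbin_down (A + b) (b + 1)
  rw [show A + b - (b + 1) + 1 = A by ring, show b + 1 - 1 = b by ring, zpow_add₀ q_ne_zero,
    zpow_one] at hv
  have hX := qbin_absorb A x
  have hY := pascal1 B y
  have hY' := pascal2 B y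
  have hZ := pascal1 B z
  have hc := pascal1 (B + c) c
  have P := algP (q ^ (w - b - c - z)) (q ^ a) (q ^ b) (q ^ c) (q ^ x) (q ^ y) (q ^ z) (q ^ A)
    (q ^ (B + 1 - y)) _ _ _ _ _ _ _ _ _ _ _ _ _ _ _ _ q hu hu' hv hX hY hY' hZ hc
  have Q := algQ (q ^ (w - b - c - z) * q ^ b) (q ^ c) (q ^ a * q ^ x * q ^ y) (q ^ A)
    (q ^ (B + 1 - y)) _ _ _ (qbin (A + b) b) (qbin A x) _ _ _ _ _ _ _ _ _ _ hu3 hY' hZ hc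
  have eb : q ^ b * q = q ^ (b + 1) := by rw [zpow_add₀ q_ne_zero, zpow_one]
  rw [eb] at P
  simp only [zmul] at P Q
  rw [← t1, ← t2, ← t3, ← t4, ← t5, ← t6] at P
  rw [← s1, ← s2, ← s3, ← t7, ← t8] at Q
  unfold pD
  rw [show b + x + z - (x - 1) - z = b + 1 by ring, show b + x + z - x - z = b by ring]
  linear_combination P + Q

lemma id_T (a b c x y z A B i j k L M : ℤ) (hi : i = a + x + y + 1) (hj : j = b + x + z)
    (hk : k = c + y + z + 1) (hL : L = A + (a + b + c + x + y + z) + 1)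
    (hM : M = B + (a + b + c + x + y + z) + 1) :
    pThird i j k L M x (y + 1) z - pX i j k L M x y z
    = pR i j k L M x y (z + 1) + q ^ i * pQ (i - 1) j k (L - 1) M (x - 1) y (z + 1) := by
  subst hi hj hk hL hM
  set w : ℤ := T (a + b + c + x + y + z) + T x + T y + T z with hw
  have hwq : (w : ℚ) = (a + b + c + x + y + z) * (a + b + c + x + y + z + 1) / 2 + x * (x + 1) / 2
      + y * (y + 1) / 2 + z * (z + 1) / 2 := by
    rw [hw]; push_cast [T_cast]; ring
  have t1 : pThird (a + x + y + 1) (b + x + z) (c + y + z + 1) (A + (a + b + c + x + y + z) + 1)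
      (B + (a + b + c + x + y + z) + 1) x (y + 1) z
      = q ^ (w + (a + b + c + x + y + z) + y + 2 + a) * qbin (A + a - 1) a * qbin (A + b) b * qbin A x
        * qbin (B + c) c * qbin B y * qbin B z := by
    unfold pThird
    apply H_congr <;> (push_cast [T_cast, hwq]; ring)
  have t2 : pX (a + x + y + 1) (b + x + z) (c + y + z + 1) (A + (a + b + c + x + y + z) + 1)
      (B + (a + b + c + x + y + z) + 1) x y z
      = q ^ (w + (a + b + c + x + y + z) + y + 2 + a + b + x) * qbin (A + a - 1) a
        * qbin (A + b - 1) b * qbin (A - 1) x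
        * qbin (B + c) c * qbin B y * qbin B z := by
    unfold pX
    apply H_congr <;> (push_cast [T_cast, hwq]; ring)
  have t3 : pR (a + x + y + 1) (b + x + z) (c + y + z + 1) (A + (a + b + c + x + y + z) + 1)
      (B + (a + b + c + x + y + z) + 1) x y (z + 1)
      = q ^ (w + (a + b + c + x + y + z) + y + 2 + a + x) * qbin (A + a - 1) a
        * qbin (A + b - 1) (b - 1) * qbin A x
        * qbin (B + c) c * qbin B y * qbin B z := by
    unfold pR
    apply H_congr <;> (push_cast [T_cast, hwq]; ring)
  have t4 : q ^ (a + x + y + 1) * pQ (a + x + y + 1 - 1) (b + x + z) (c + y + z + 1)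
      (A + (a + b + c + x + y + z) + 1 - 1)
      (B + (a + b + c + x + y + z) + 1) (x - 1) y (z + 1)
      = q ^ (w + (a + b + c + x + y + z) + y + 2 + a) * qbin (A + a - 1) a
        * qbin (A + b - 1) b * qbin (A - 1) (x - 1)
        * qbin (B + c) c * qbin B y * qbin B z := by
    unfold pQ
    rw [q_mul_H]
    apply H_congr <;> (push_cast [T_cast, hwq]; ring)
  rw [t1, t2, t3, t4]
  simp only [← zmul]
  have hv := pascal1 (A + b - 1) b
  rw [show A + b - 1 + 1 = A + b by ring] at hv
  have hX := pascal1 (A - 1) x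
  rw [show A - 1 + 1 = A by ring] at hX
  have hX' := qbin_absorb A x
  have hv' := qbin_down (A + b - 1) b
  rw [show A + b - 1 - b + 1 = A by ring] at hv'
  exact algT _ _ _ _ _ _ _ _ _ _ _ _ _ _ hv hX hX' hv'

/-- sum over all integer triples -/
noncomputable def S (f : ℤ → ℤ → ℤ → RatFunc ℚ) : RatFunc ℚ :=
  ∑ᶠ p : ℤ × ℤ × ℤ, f p.1 p.2.1 p.2.2

lemma S_shift (f : ℤ → ℤ → ℤ → RatFunc ℚ) (u v w : ℤ) :
    S (fun x y z => f (x + u) (y + v) (z + w)) = S f := by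
  unfold S
  exact finsum_comp_equiv (Equiv.addRight ((u, v, w) : ℤ × ℤ × ℤ))
    (f := fun p : ℤ × ℤ × ℤ => f p.1 p.2.1 p.2.2)

noncomputable def Box (i j : ℤ) : Finset (ℤ × ℤ × ℤ) :=
  Finset.Icc (-9) (i + 9) ×ˢ Finset.Icc (-9) (i + 9) ×ˢ Finset.Icc (-9) (j + 9)

lemma S_box (i j : ℤ) (f : ℤ → ℤ → ℤ → RatFunc ℚ)
    (h : ∀ x y z, f x y z ≠ 0 → -9 ≤ x ∧ -9 ≤ y ∧ -9 ≤ z ∧ x ≤ i + 9 ∧ y ≤ i + 9 ∧ z ≤ j + 9) :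
    S f = ∑ p ∈ Box i j, f p.1 p.2.1 p.2.2 := by
  unfold S
  apply finsum_eq_sum_of_support_subset
  rintro ⟨x, y, z⟩ hp
  have := h x y z hp
  simp only [Box, Finset.coe_product, Finset.coe_Icc, Set.mem_prod, Set.mem_Icc]
  omega

noncomputable def G (i j k L M : ℤ) : RatFunc ℚ :=
  S (fun x y z => pP i j k L M x y z + pQ i j k L M x y z)

lemma pP_supp {i j k L M x y z : ℤ} (h : pP i j k L M x y z ≠ 0) :
    0 ≤ i - x - y ∧ 0 ≤ j - x - z ∧ 0 ≤ x ∧ 0 ≤ k - y - z ∧ 0 ≤ y ∧ 0 ≤ z := H_supp h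

lemma pQ_supp {i j k L M x y z : ℤ} (h : pQ i j k L M x y z ≠ 0) :
    0 ≤ i - x - y - 1 ∧ 0 ≤ j - x - z ∧ 0 ≤ x ∧ 0 ≤ k - y - z ∧ 0 ≤ y ∧ 0 ≤ z - 1 := H_supp h

lemma pPQ_supp {i j k L M x y z : ℤ} (h : pP i j k L M x y z + pQ i j k L M x y z ≠ 0) :
    0 ≤ i - x - y ∧ 0 ≤ j - x - z ∧ 0 ≤ x ∧ 0 ≤ k - y - z ∧ 0 ≤ y ∧ 0 ≤ z := by
  by_cases h1 : pP i j k L M x y z = 0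
  · rw [h1, zero_add] at h
    have := pQ_supp h
    omega
  · exact pP_supp h1

lemma G_rec (i j k L M : ℤ) :
    (1 - q ^ i) * G i j k L M = q ^ i * G (i - 1) j k (L - 1) M
      - q ^ (M + 1) * G (i - 1) j (k - 1) (L - 1) (M - 1)
      - q ^ (i + L) * G (i - 1) j k (L - 1) (M - 1) := by
  have b0 := S_box i j (fun x y z => pP i j k L M x y z + pQ i j k L M x y z)
    (fun x y z h => by have := pPQ_supp h; omega)
  have b1 := S_box i j (fun x y z => pP (i - 1) j (k - 1) (L - 1) (M - 1) x (y - 1) z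
      + pQ (i - 1) j (k - 1) (L - 1) (M - 1) x (y - 1) z)
    (fun x y z h => by have := pPQ_supp h; omega)
  have b2 := S_box i j (fun x y z => pP (i - 1) j k (L - 1) (M - 1) x y z
      + pQ (i - 1) j k (L - 1) (M - 1) x y z)
    (fun x y z h => by have := pPQ_supp h; omega)
  have b3 := S_box i j (fun x y z => pP (i - 1) j k (L - 1) M x y z
      + pQ (i - 1) j k (L - 1) M x y z)
    (fun x y z h => by have := pPQ_supp h; omega)
  have b3Q := S_box i j (fun x y z => pQ (i - 1) j k (L - 1) M x y z)
    (fun x y z h => by have := pQ_supp h; omega)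
  have b3Q' := S_box i j (fun x y z => pQ (i - 1) j k (L - 1) M (x - 1) y (z + 1))
    (fun x y z h => by have := pQ_supp h; omega)
  have bD := S_box i j (fun x y z => pD i j k L M x y z)
    (fun x y z h => by have := pP_supp (right_ne_zero_of_mul h); omega)
  have bD' := S_box i j (fun x y z => pD i j k L M (x - 1) y z)
    (fun x y z h => by have := pP_supp (right_ne_zero_of_mul h); omega)
  have bT := S_box i j (fun x y z => pThird i j k L M x y z)
    (fun x y z h => by have := H_supp h; omega)
  have bT' := S_box i j (fun x y z => pThird i j k L M x (y + 1) z)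
    (fun x y z h => by have := H_supp h; omega)
  have bX := S_box i j (fun x y z => pX i j k L M x y z)
    (fun x y z h => by have := H_supp h; omega)
  have bR := S_box i j (fun x y z => pR i j k L M x y z)
    (fun x y z h => by have := H_supp h; omega)
  have bR' := S_box i j (fun x y z => pR i j k L M x y (z + 1))
    (fun x y z h => by have := H_supp h; omega)
  have s1 := S_shift (fun x y z => pP (i - 1) j (k - 1) (L - 1) (M - 1) x y z
      + pQ (i - 1) j (k - 1) (L - 1) (M - 1) x y z) 0 (-1) 0
  have s2 := S_shift (fun x y z => pQ (i - 1) j k (L - 1) M x y z) (-1) 0 1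
  have s3 := S_shift (fun x y z => pD i j k L M x y z) (-1) 0 0
  have s4 := S_shift (fun x y z => pThird i j k L M x y z) 0 1 0
  have s5 := S_shift (fun x y z => pR i j k L M x y z) 0 0 1
  simp only [add_zero, ← sub_eq_add_neg] at s1 s2 s3 s4 s5
  rw [b1] at s1
  rw [b3Q', b3Q] at s2
  rw [bD', bD] at s3
  rw [bT', bT] at s4
  rw [bR', bR] at s5
  have i1 := Finset.sum_congr (rfl : Box i j = Box i j) (fun p _ =>
    id_point (i - p.1 - p.2.1) (j - p.1 - p.2.2) (k - p.2.1 - p.2.2) p.1 p.2.1 p.2.2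
      (L - (i + j + k - p.1 - p.2.1 - p.2.2)) (M - (i + j + k - p.1 - p.2.1 - p.2.2)) i j k L M
      (by ring) (by ring) (by ring) (by ring) (by ring))
  have i2 := Finset.sum_congr (rfl : Box i j = Box i j) (fun p _ =>
    id_T (i - 1 - p.1 - p.2.1) (j - p.1 - p.2.2) (k - 1 - p.2.1 - p.2.2) p.1 p.2.1 p.2.2
      (L - (i + j + k - p.1 - p.2.1 - p.2.2) + 1) (M - (i + j + k - p.1 - p.2.1 - p.2.2) + 1) i j k L M
      (by ring) (by ring) (by ring) (by ring) (by ring))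
  unfold G
  rw [← s1, b0, b2, b3]
  simp only [Finset.sum_add_distrib, Finset.sum_sub_distrib, ← Finset.mul_sum, mul_add]
    at i1 i2 s1 s2 s3 s4 s5 ⊢
  linear_combination i1 + i2 + s3 - s4 + s5 + q ^ i * s2

lemma g_eq_G (i j k L M : ℤ) : g i j k L L M = G i j k L M := by
  classical
  let emb : ℕ × ℕ × ℕ ↪ ℤ × ℤ × ℤ :=
    ⟨fun p => ((p.1 : ℤ), (p.2.1 : ℤ), (p.2.2 : ℤ)), by
      rintro ⟨a, b, c⟩ ⟨a', b', c'⟩ h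
      simpa using h⟩
  have h : G i j k L M = ∑ p ∈ (Finset.range (i.toNat + 1) ×ˢ Finset.range (i.toNat + 1) ×ˢ
      Finset.range (j.toNat + 1)).map emb, (pP i j k L M p.1 p.2.1 p.2.2 + pQ i j k L M p.1 p.2.1 p.2.2) := by
    unfold G S
    apply finsum_eq_sum_of_support_subset
    rintro ⟨x, y, z⟩ hp
    have : 0 ≤ i - x - y ∧ 0 ≤ j - x - z ∧ 0 ≤ x ∧ 0 ≤ k - y - z ∧ 0 ≤ y ∧ 0 ≤ z := pPQ_supp hp
    simp only [Finset.coe_map, Set.mem_image]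
    refine ⟨(x.toNat, y.toNat, z.toNat), ?_, ?_⟩
    · simp only [Finset.coe_product, Set.mem_prod, Finset.coe_range, Set.mem_Iio]
      omega
    · show ((x.toNat : ℤ), (y.toNat : ℤ), (z.toNat : ℤ)) = (x, y, z)
      simp only [Prod.mk.injEq]
      omega
  rw [h, Finset.sum_map, Finset.sum_product]
  simp only [Finset.sum_product]
  unfold g
  refine Finset.sum_congr rfl fun x _ => Finset.sum_congr rfl fun y _ =>
    Finset.sum_congr rfl fun z _ => ?_
  change (if _ then _ else _) = pP i j k L M (x : ℤ) (y : ℤ) (z : ℤ) + pQ i j k L M (x : ℤ) (y : ℤ) (z : ℤ)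
  split_ifs with hc
  · have et : i - (x : ℤ) - y + (j - x - z) + (k - y - z) + x + y + z = i + j + k - x - y - z := by ring
    simp only [et, pP, pQ, H]
    have e1 : T (i + j + k - x - y - z) + T x + T y + T z
        = T (i + j + k - x - y - z) + T x + T y + T (z - 1) + z := by
      apply Int.cast_injective (α := ℚ)
      push_cast [T_cast]; ring
    rw [e1, ← zmul _ (z : ℤ)]
    ring
  · symm
    by_contra h0
    have := pPQ_supp h0
    omega

lemma trinom (N : ℤ) (n m : ℕ) :
    qbin N n * qbin (N - n) m = qbin N (n + m) * qbin (n + m) m := by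
  induction m with
  | zero => simp [qbin_zero]
  | succ m ih =>
    have h1 := one_sub_q_ne ((m : ℤ) + 1) (by omega)
    have d1 := qbin_down (N - n) (m + 1)
    have d2 := qbin_down N (n + m + 1)
    have d3 := qbin_absorb (n + m + 1) (m + 1)
    rw [show (m : ℤ) + 1 - 1 = m by ring, show N - n - ((m : ℤ) + 1) + 1 = N - n - m by ring] at d1
    rw [show (n : ℤ) + m + 1 - 1 = n + m by ring,
      show N - ((n : ℤ) + m + 1) + 1 = N - n - m by ring] at d2
    rw [show (m : ℤ) + 1 - 1 = m by ring, show (n : ℤ) + m + 1 - 1 = n + m by ring] at d3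
    push_cast
    rw [← add_assoc]
    apply mul_left_cancel₀ h1
    linear_combination qbin N n * d1 + (1 - q ^ (N - n - m)) * ih - qbin N (n + m + 1) * d3
      - qbin (n + m) m * d2

lemma qbin_zero_top (n : ℤ) (hn : 0 < n) : qbin 0 n = 0 := by
  have h := qbin_absorb 0 n
  rw [zpow_zero, sub_self, zero_mul] at h
  exact (mul_eq_zero.mp h).resolve_left (one_sub_q_ne n hn)

lemma qbin_small (n m : ℕ) (h : n < m) : qbin n m = 0 := by
  induction n generalizing m with
  | zero => exact qbin_zero_top m (by omega)
  | succ n ih =>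
    have h2 := qbin_absorb ((n + 1 : ℕ) : ℤ) m
    rw [show (((n + 1 : ℕ) : ℤ) - 1) = (n : ℤ) by push_cast; ring,
      show (m : ℤ) - 1 = ((m - 1 : ℕ) : ℤ) by omega, ih _ (by omega), mul_zero] at h2
    exact (mul_eq_zero.mp h2).resolve_left (one_sub_q_ne m (by omega))

noncomputable def F0 (j k L M m : ℤ) : RatFunc ℚ :=
  q ^ (T (j + k - m) + T m) * qbin (L - k) (j - m) * qbin (M - j) (k - m) * qbin (M - j - k + m) m

lemma F0_step (j k L M m : ℤ) :
    F0 j k (L + 1) M m = F0 j k L M m + q ^ (L + 1) * F0 (j - 1) k L (M - 1) m := by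
  have h := pascal2 (L - k) (j - m)
  have e : q ^ (T (j + k - m) + T m) * q ^ (L - k + 1 - (j - m))
      = q ^ (L + 1) * q ^ (T (j - 1 + k - m) + T m) := by
    rw [zmul, zmul]; congr 1
    apply Int.cast_injective (α := ℚ)
    push_cast [T_cast]; ring
  unfold F0
  rw [show L + 1 - k = L - k + 1 by ring, h, show j - 1 - m = j - m - 1 by ring,
    show M - 1 - (j - 1) = M - j by ring]
  linear_combination (qbin (L - k) (j - m - 1) * qbin (M - j) (k - m) * qbin (M - j - k + m) m) * e

lemma base (j : ℕ) (k L M : ℤ) (hk : 0 ≤ k) :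
    ∑ m ∈ Finset.range (j + 1), F0 j k L M m
      = q ^ (T j + T k) * qbin L j * qbin (M - j) k := by
  obtain ⟨k, rfl⟩ := Int.eq_ofNat_of_zero_le hk
  induction j generalizing L M with
  | zero =>
    simp [F0, qbin_zero, T]
  | succ j ih =>
    have step : ∀ L : ℤ, ∑ m ∈ Finset.range (j + 1 + 1), F0 ((j + 1 : ℕ) : ℤ) k (L + 1) M m
        = ∑ m ∈ Finset.range (j + 1 + 1), F0 ((j + 1 : ℕ) : ℤ) k L M m
          + q ^ (L + 1) * (q ^ (T j + T k) * qbin L j * qbin (M - 1 - j) k) := by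
      intro L
      rw [← ih L (M - 1)]
      have hz : F0 j k L (M - 1) ((j + 1 : ℕ) : ℤ) = 0 := by
        unfold F0; rw [qbin_neg _ ((j : ℤ) - ((j + 1 : ℕ) : ℤ)) (by push_cast; omega)]; simp
      have : ∑ m ∈ Finset.range (j + 1), F0 j k L (M - 1) m
          = ∑ m ∈ Finset.range (j + 1 + 1), F0 j k L (M - 1) m := by
        rw [Finset.sum_range_succ _ (j + 1), hz, add_zero]
      rw [this, Finset.mul_sum, ← Finset.sum_add_distrib]
      refine Finset.sum_congr rfl fun m _ => ?_
      rw [F0_step, show ((j + 1 : ℕ) : ℤ) - 1 = j by push_cast; ring]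
    have step2 : ∀ L : ℤ, q ^ (T ((j + 1 : ℕ) : ℤ) + T k) * qbin (L + 1) ((j + 1 : ℕ) : ℤ)
          * qbin (M - ((j + 1 : ℕ) : ℤ)) k
        = q ^ (T ((j + 1 : ℕ) : ℤ) + T k) * qbin L ((j + 1 : ℕ) : ℤ) * qbin (M - ((j + 1 : ℕ) : ℤ)) k
          + q ^ (L + 1) * (q ^ (T j + T k) * qbin L j * qbin (M - 1 - j) k) := by
      intro L
      have e : q ^ (T ((j + 1 : ℕ) : ℤ) + T k) * q ^ (L + 1 - ((j + 1 : ℕ) : ℤ))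
          = q ^ (L + 1) * q ^ (T j + T k) := by
        rw [zmul, zmul]; congr 1
        apply Int.cast_injective (α := ℚ)
        push_cast [T_cast]; ring
      rw [pascal2, show ((j + 1 : ℕ) : ℤ) - 1 = j by push_cast; ring,
        show M - ((j + 1 : ℕ) : ℤ) = M - 1 - j by push_cast; ring]
      linear_combination (qbin L j * qbin (M - 1 - j) k) * e
    have key : ∑ m ∈ Finset.range (j + 1 + 1), F0 ((j + 1 : ℕ) : ℤ) k k M m
        = q ^ (T ((j + 1 : ℕ) : ℤ) + T k) * qbin k ((j + 1 : ℕ) : ℤ)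
          * qbin (M - ((j + 1 : ℕ) : ℤ)) k := by
      rw [Finset.sum_eq_single (j + 1)]
      · generalize j + 1 = J
        unfold F0
        rw [sub_self, sub_self, qbin_zero, show (J : ℤ) + k - J = k by ring]
        rcases le_or_gt J k with h | h
        · obtain ⟨n, rfl⟩ := Nat.exists_eq_add_of_le h
          have := trinom (M - J) n J
          rw [show M - J - (n : ℤ) = M - J - ((J + n : ℕ) : ℤ) + J by push_cast; ring,
            show (n : ℤ) = ((J + n : ℕ) : ℤ) - J by push_cast; ring] at this
          rw [show ((J + n : ℕ) : ℤ) - J + J = ((J + n : ℕ) : ℤ) by ring] at this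
          rw [add_comm (T (J : ℤ))]
          linear_combination q ^ (T ((J + n : ℕ) : ℤ) + T J) * this
        · rw [qbin_small k J h, qbin_neg _ ((k : ℤ) - J) (by omega)]; simp
      · intro m hm hne
        have : m < j + 1 := by have := Finset.mem_range.mp hm; omega
        unfold F0
        rw [sub_self, qbin_zero_top _ (by push_cast; omega)]; simp
      · simp
    have up : ∀ n : ℕ, ∑ m ∈ Finset.range (j + 1 + 1), F0 ((j + 1 : ℕ) : ℤ) k (k + n) M m
        = q ^ (T ((j + 1 : ℕ) : ℤ) + T k) * qbin (k + n) ((j + 1 : ℕ) : ℤ)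
          * qbin (M - ((j + 1 : ℕ) : ℤ)) k := by
      intro n
      induction n with
      | zero => simpa using key
      | succ n hn =>
        rw [show (k : ℤ) + ((n + 1 : ℕ) : ℤ) = k + n + 1 by push_cast; ring, step, step2, hn]
    have down : ∀ n : ℕ, ∑ m ∈ Finset.range (j + 1 + 1), F0 ((j + 1 : ℕ) : ℤ) k (k - n) M m
        = q ^ (T ((j + 1 : ℕ) : ℤ) + T k) * qbin (k - n) ((j + 1 : ℕ) : ℤ)
          * qbin (M - ((j + 1 : ℕ) : ℤ)) k := by
      intro n
      induction n with
      | zero => simpa using key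
      | succ n hn =>
        have a1 := step (k - ((n + 1 : ℕ) : ℤ))
        have a2 := step2 (k - ((n + 1 : ℕ) : ℤ))
        rw [show (k : ℤ) - ((n + 1 : ℕ) : ℤ) + 1 = k - n by push_cast; ring] at a1 a2
        linear_combination hn - a1 + a2
    rcases le_total (k : ℤ) L with h | h
    · have := up (L - k).toNat
      rwa [show (k : ℤ) + ((L - k).toNat : ℤ) = L by omega] at this
    · have := down (k - L).toNat
      rwa [show (k : ℤ) - ((k - L).toNat : ℤ) = L by omega] at this

/-- summand of the right-hand side -/
noncomputable def r (i j k L M s : ℤ) : RatFunc ℚ :=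
  q ^ (s * (M + 2) - T s + T (i - s) + T (j - s) + T (k - s)) *
          (qbin (L - s) s * qbin (L - 2 * s) (i - s) * qbin (L - s - i) (j - s)) *
          qbin (M - i - j) (k - s)

noncomputable def R (n : ℕ) (j k L M : ℤ) : RatFunc ℚ :=
  ∑ s ∈ Finset.range (n + 1), r n j k L M s

lemma r_first (i j k L M s : ℤ) :
    q ^ s * (1 - q ^ (i - s)) * r i j k L M s
     = q ^ (s * (M + 2) - T s + T (i - s) + T (j - s) + T (k - s)) * (q ^ s - q ^ L) *
       (qbin (L - 1 - s) s * qbin (L - 1 - 2 * s) (i - 1 - s) * qbin (L - s - i) (j - s))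
        * qbin (M - i - j) (k - s) := by
  have h1 := qbin_absorb (L - 2 * s) (i - s)
  have h2 := qbin_left (L - s) s
  rw [show L - s - s = L - 2 * s by ring, show L - s - 1 = L - 1 - s by ring] at h2
  rw [show L - 2 * s - 1 = L - 1 - 2 * s by ring, show i - s - 1 = i - 1 - s by ring] at h1
  have e : q ^ L = q ^ s * q ^ (L - s) := by rw [zmul]; congr 1; ring
  rw [e]
  unfold r
  generalize q ^ (s * (M + 2) - T s + T (i - s) + T (j - s) + T (k - s)) = W
  linear_combination (W * q ^ s * qbin (L - s) s * qbin (L - s - i) (j - s) * qbin (M - i - j) (k - s)) * h1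
   + (W * q ^ s * qbin (L - 1 - 2 * s) (i - 1 - s) * qbin (L - s - i) (j - s) * qbin (M - i - j) (k - s)) * h2

lemma r_second (i j k L M s : ℤ) :
    (1 - q ^ (s + 1)) * r i j k L M (s + 1)
     = q ^ (s * (M + 2) - T s + T (i - s) + T (j - s) + T (k - s)) *
       (q ^ (M + 1 - i - j - k + 2 * s) * (1 - q ^ (j - s))) *
       (qbin (L - 1 - s) s * qbin (L - 1 - 2 * s) (i - 1 - s) * qbin (L - s - i) (j - s))
        * qbin (M - i - j) (k - s - 1) := by
  -- reduce the top of the first two coefficients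
  have h1 := qbin_down (L - 1 - s) (s + 1)
  rw [show L - 1 - s - (s + 1) + 1 = L - 1 - 2 * s by ring, show s + 1 - 1 = s by ring] at h1
  have h2 := qbin_left (L - 1 - 2 * s) (i - 1 - s)
  rw [show L - 1 - 2 * s - (i - 1 - s) = L - s - i by ring,
    show L - 1 - 2 * s - 1 = L - 2 * (s + 1) by ring] at h2
  have h3 := qbin_absorb (L - s - i) (j - s)
  rw [show L - s - i - 1 = L - (s + 1) - i by ring, show j - s - 1 = j - (s + 1) by ring] at h3
  have e : q ^ ((s + 1) * (M + 2) - T (s + 1) + T (i - (s + 1)) + T (j - (s + 1)) + T (k - (s + 1)))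
    = q ^ (s * (M + 2) - T s + T (i - s) + T (j - s) + T (k - s)) *
       q ^ (M + 1 - i - j - k + 2 * s) := by
    rw [zmul]; congr 1
    apply Int.cast_injective (α := ℚ)
    push_cast [T_cast]; ring
  unfold r
  rw [e, show L - (s + 1) = L - 1 - s by ring, show k - (s + 1) = k - s - 1 by ring,
    show i - (s + 1) = i - 1 - s by ring]
  rw [show L - (s + 1) - i = L - 1 - s - i by ring] at h3
  generalize q ^ (s * (M + 2) - T s + T (i - s) + T (j - s) + T (k - s)) = W
  generalize q ^ (M + 1 - i - j - k + 2 * s) = V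
  linear_combination
    (W * V * qbin (L - 2 * (s + 1)) (i - 1 - s) * qbin (L - 1 - s - i) (j - (s + 1))
      * qbin (M - i - j) (k - s - 1)) * h1
    - (W * V * qbin (L - 1 - s) s * qbin (L - 1 - s - i) (j - (s + 1))
      * qbin (M - i - j) (k - s - 1)) * h2
    - (W * V * qbin (L - 1 - s) s * qbin (L - 1 - 2 * s) (i - 1 - s)
      * qbin (M - i - j) (k - s - 1)) * h3

lemma r_point (i j k L M s : ℤ) :
    q ^ s * (1 - q ^ (i - s)) * r i j k L M s + (1 - q ^ (s + 1)) * r i j k L M (s + 1)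
    = q ^ i * r (i - 1) j k (L - 1) M s - q ^ (M + 1) * r (i - 1) j (k - 1) (L - 1) (M - 1) s
      - q ^ (i + L) * r (i - 1) j k (L - 1) (M - 1) s := by
  rw [r_first, r_second]
  have hp := pascal2 (M - i - j) (k - s)
  set w : ℤ := s * (M + 2) - T s + T (i - s) + T (j - s) + T (k - s) with hw
  have e1 : q ^ i * q ^ (s * (M + 2) - T s + T (i - 1 - s) + T (j - s) + T (k - s))
      = q ^ w * q ^ s := by
    rw [zmul, zmul]; congr 1
    apply Int.cast_injective (α := ℚ)
    push_cast [T_cast, hw]; ring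
  have e2 : q ^ (M + 1) * q ^ (s * (M - 1 + 2) - T s + T (i - 1 - s) + T (j - s) + T (k - 1 - s))
      = q ^ w * (q ^ (M + 1 - i - j - k + 2 * s) * q ^ (j - s)) := by
    rw [zmul, zmul, zmul]; congr 1
    apply Int.cast_injective (α := ℚ)
    push_cast [T_cast, hw]; ring
  have e3 : q ^ (i + L) * q ^ (s * (M - 1 + 2) - T s + T (i - 1 - s) + T (j - s) + T (k - s))
      = q ^ w * q ^ L := by
    rw [zmul, zmul]; congr 1
    apply Int.cast_injective (α := ℚ)
    push_cast [T_cast, hw]; ring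
  have e4 : q ^ (M + 1 - i - j - k + 2 * s) = q ^ s * q ^ (M - i - j + 1 - (k - s)) := by
    rw [zmul]; congr 1; ring
  unfold r
  rw [show M - (i - 1) - j = M - i - j + 1 by ring, show M - 1 - (i - 1) - j = M - i - j by ring,
    show L - 1 - s - (i - 1) = L - s - i by ring, hp, show k - 1 - s = k - s - 1 by ring]
  rw [show k - 1 - s = k - s - 1 by ring] at e2
  generalize qbin (L - 1 - s) s * qbin (L - 1 - 2 * s) (i - 1 - s) * qbin (L - s - i) (j - s) = C
  generalize qbin (M - i - j) (k - s) = c0 at *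
  generalize qbin (M - i - j) (k - s - 1) = c1 at *
  linear_combination (-(c0 + q ^ (M - i - j + 1 - (k - s)) * c1) * C) * e1 + (C * c1) * e2 + (C * c0) * e3
    + (q ^ w * C * c1) * e4

lemma R_rec (n : ℕ) (j k L M : ℤ) :
    (1 - q ^ ((n : ℤ) + 1)) * R (n + 1) j k L M = q ^ ((n : ℤ) + 1) * R n j k (L - 1) M
      - q ^ (M + 1) * R n j (k - 1) (L - 1) (M - 1)
      - q ^ ((n : ℤ) + 1 + L) * R n j k (L - 1) (M - 1) := by
  have h1 : (1 - q ^ ((n : ℤ) + 1)) * R (n + 1) j k L M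
      = ∑ s ∈ Finset.range (n + 1 + 1),
          q ^ (s : ℤ) * (1 - q ^ ((n : ℤ) + 1 - s)) * r (n + 1) j k L M s
        + ∑ s ∈ Finset.range (n + 1 + 1), (1 - q ^ (s : ℤ)) * r (n + 1) j k L M s := by
    unfold R
    rw [Finset.mul_sum, ← Finset.sum_add_distrib]
    refine Finset.sum_congr rfl fun s _ => ?_
    have e : q ^ ((n : ℤ) + 1) = q ^ (s : ℤ) * q ^ ((n : ℤ) + 1 - s) := by rw [zmul]; congr 1; ring
    push_cast
    rw [e]; ring
  rw [h1, Finset.sum_range_succ, Finset.sum_range_succ' _ (n + 1)]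
  have z1 : (1 : RatFunc ℚ) - q ^ ((n : ℤ) + 1 - ((n + 1 : ℕ) : ℤ)) = 0 := by push_cast; simp
  have z2 : (1 : RatFunc ℚ) - q ^ (((0 : ℕ) : ℤ)) = 0 := by simp
  rw [z1, z2, mul_zero, zero_mul, zero_mul, add_zero, add_zero, ← Finset.sum_add_distrib]
  unfold R
  rw [Finset.mul_sum, Finset.mul_sum, Finset.mul_sum, ← Finset.sum_sub_distrib,
    ← Finset.sum_sub_distrib]
  refine Finset.sum_congr rfl fun s _ => ?_
  have := r_point ((n : ℤ) + 1) j k L M s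
  rw [show (n : ℤ) + 1 - 1 = n by ring] at this
  push_cast
  exact this

lemma G_neg (i j k L M : ℤ) (h : i < 0 ∨ j < 0 ∨ k < 0) : G i j k L M = 0 := by
  unfold G S
  rw [← finsum_zero (α := ℤ × ℤ × ℤ)]
  congr 1
  funext p
  by_contra h0
  have := pPQ_supp h0
  omega

lemma R_neg (n : ℕ) (j k L M : ℤ) (h : j < 0 ∨ k < 0) : R n j k L M = 0 := by
  unfold R
  refine Finset.sum_eq_zero fun s _ => ?_
  unfold r
  rcases h with h | h
  · rw [qbin_neg _ (j - s) (by omega)]; simp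
  · rw [qbin_neg _ (k - s) (by omega)]; simp

lemma G_zero (j k L M : ℤ) : G 0 j k L M = R 0 j k L M := by
  by_cases h : j < 0 ∨ k < 0
  · rw [G_neg _ _ _ _ _ (Or.inr h), R_neg _ _ _ _ _ h]
  · obtain ⟨j, rfl⟩ := Int.eq_ofNat_of_zero_le (show 0 ≤ j by omega)
    have hb := base j k L M (by omega)
    have hR : R 0 j k L M = q ^ (T j + T k) * qbin L j * qbin (M - j) k := by
      simp [R, r, qbin_zero, T]
    rw [hR, ← hb]
    unfold G S
    let emb : ℕ ↪ ℤ × ℤ × ℤ := ⟨fun m => (0, 0, (m : ℤ)), by intro a b h; simpa using h⟩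
    rw [finsum_eq_sum_of_support_subset (s := (Finset.range (j + 1)).map emb), Finset.sum_map]
    · refine Finset.sum_congr rfl fun m _ => ?_
      have hQ : pQ 0 j k L M 0 0 m = 0 := by
        by_contra h0
        have := pQ_supp h0
        omega
      show pP 0 j k L M 0 0 m + pQ 0 j k L M 0 0 m = F0 j k L M m
      rw [hQ, add_zero]
      unfold F0 pP
      rw [H_congr (e' := T (j + k - m) + T m) (n1' := L - (j + k - m)) (m1' := 0)
        (n2' := L - k) (m2' := j - m) (n3' := L - (j + k - m)) (m3' := 0)
        (n4' := M - j) (m4' := k - m) (n5' := M - (j + k - m)) (m5' := 0)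
        (n6' := M - j - k + m) (m6' := m)]
      · simp only [qbin_zero]; ring
      all_goals (push_cast [T_cast]; try ring)
    · rintro ⟨x, y, z⟩ hp
      have : 0 ≤ 0 - x - y ∧ 0 ≤ (j : ℤ) - x - z ∧ 0 ≤ x ∧ 0 ≤ k - y - z ∧ 0 ≤ y ∧ 0 ≤ z := pPQ_supp hp
      simp only [Finset.coe_map, Set.mem_image]
      refine ⟨z.toNat, ?_, ?_⟩
      · simp only [Finset.coe_range, Set.mem_Iio]; omega
      · show ((0 : ℤ), (0 : ℤ), (z.toNat : ℤ)) = (x, y, z)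
        simp only [Prod.mk.injEq]; omega

lemma G_eq_R (n : ℕ) (j k L M : ℤ) : G n j k L M = R n j k L M := by
  induction n generalizing k L M with
  | zero => exact G_zero j k L M
  | succ n ih =>
    have h1 := G_rec ((n : ℤ) + 1) j k L M
    rw [show (n : ℤ) + 1 - 1 = n by ring, ih, ih, ih, ← R_rec] at h1
    push_cast
    exact mul_left_cancel₀ (one_sub_q_ne _ (by omega)) h1

/-- Double bounded polynomial key identity (Theorem 3 of Alladi–Berkovich):
the six-fold sum with `L1 = L2 = L` equals the single sum whose summand uses the
$q$-multinomial `C(L-s over s, i-s, j-s) = C(L-s, s) C(L-2s, i-s) C(L-s-i, j-s)`.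
Terms with `s > i` vanish since `qbin (L - 2*s) (i - s) = 0` for `i - s < 0`. -/
theorem double_bounded_key_identity (i j k L M : ℤ) :
    g i j k L L M =
      ∑ s ∈ Finset.range (i.toNat + 1),
        q ^ ((s : ℤ) * (M + 2) - T s + T (i - s) + T (j - s) + T (k - s)) *
          (qbin (L - s) s * qbin (L - 2 * s) (i - s) * qbin (L - s - i) (j - s)) *
          qbin (M - i - j) (k - s) := by 
  rw [g_eq_G]
  by_cases h : i < 0
  · rw [G_neg _ _ _ _ _ (Or.inl h)]
    symm
    refine Finset.sum_eq_zero fun s _ => ?_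
    rw [qbin_neg _ (i - s) (by omega)]; simp
  · obtain ⟨n, rfl⟩ := Int.eq_ofNat_of_zero_le (show 0 ≤ i by omega)
    exact G_eq_R n j k L M
end

section
/- Boundary evaluation at L1 = i-1: g_{i,j,k}(i-1, L2, M) = q^{i(M+2) - T_i + T_{j-i} + T_{k-i}} · C(L2 - i, j - i) · C(L2 - j, i) · C(M - i - j, k - i), for nonnegative integers i, j, k and integers L2, M, where g is the triple sum of Theorem 5. -/
open Finset

namespace BR

lemma q_ne : q ≠ 0 := RatFunc.X_ne_zero

lemma one_sub_q_pow_ne (n : ℕ) : (1 : RatFunc ℚ) - q ^ (n + 1) ≠ 0 := by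
  intro h
  have h1 : (1 : RatFunc ℚ) = q ^ (n + 1) := sub_eq_zero.mp h
  unfold q at h1
  rw [← RatFunc.algebraMap_X, ← map_pow, ← map_one (algebraMap (Polynomial ℚ) (RatFunc ℚ))] at h1
  have h2 := RatFunc.algebraMap_injective ℚ h1
  have h3 := congrArg Polynomial.natDegree h2
  simp at h3

lemma one_sub_q_zpow_ne (n : ℤ) (hn : 0 < n) : (1 : RatFunc ℚ) - q ^ n ≠ 0 := by
  obtain ⟨m, rfl⟩ : ∃ m : ℕ, n = ((m + 1 : ℕ) : ℤ) := ⟨(n - 1).toNat, by omega⟩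
  rw [zpow_natCast]
  exact one_sub_q_pow_ne m

lemma qbin_neg (N n : ℤ) (h : n < 0) : qbin N n = 0 := by
  simp [qbin, h]

lemma qbin_zero (N : ℤ) : qbin N 0 = 1 := by
  simp [qbin]

lemma qbin_nat (N : ℤ) (n : ℕ) : qbin N n =
    ∏ r ∈ Finset.range n, (1 - q ^ (N - (r : ℤ))) / (1 - q ^ ((r : ℤ) + 1)) := by
  simp [qbin]

lemma qbin_oor (N n : ℤ) (h0 : 0 ≤ N) (h : N < n) : qbin N n = 0 := by
  obtain ⟨m, rfl⟩ : ∃ m : ℕ, n = m := ⟨n.toNat, by omega⟩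
  rw [qbin_nat]
  apply Finset.prod_eq_zero (i := N.toNat) (by simp; omega)
  rw [Int.toNat_of_nonneg h0]
  simp

/-- absorption, natural lower index -/
lemma absorb_nat (N : ℤ) (n : ℕ) : qbin N ((n : ℤ) + 1) * (1 - q ^ ((n : ℤ) + 1)) =
    qbin N n * (1 - q ^ (N - n)) := by
  have h := qbin_nat N (n + 1)
  rw [Finset.prod_range_succ, ← qbin_nat] at h
  push_cast at h
  rw [h]
  have := one_sub_q_zpow_ne ((n : ℤ) + 1) (by omega)
  field_simp

lemma absorb (N n : ℤ) : qbin N n * (1 - q ^ n) = qbin N (n - 1) * (1 - q ^ (N - n + 1)) := by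
  rcases lt_trichotomy n 0 with h | h | h
  · rw [qbin_neg _ _ h, qbin_neg _ _ (by omega)]; simp
  · subst h; rw [qbin_neg N (0 - 1) (by omega)]; simp
  · obtain ⟨m, rfl⟩ : ∃ m : ℕ, n = (m : ℤ) + 1 := ⟨(n - 1).toNat, by omega⟩
    rw [absorb_nat]
    congr 2
    · ring
    · congr 2; ring

/-- the other absorption -/
lemma absorb_top_nat (N : ℤ) (n : ℕ) : qbin N ((n : ℤ) + 1) * (1 - q ^ ((n : ℤ) + 1)) =
    qbin (N - 1) n * (1 - q ^ N) := by
  induction n with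
  | zero => have := absorb_nat N 0; simpa [qbin_zero] using this
  | succ n ih =>
    have h1 := absorb_nat N (n + 1)
    have h2 := absorb_nat (N - 1) n
    push_cast at h1 ⊢
    have h3 := one_sub_q_zpow_ne ((n : ℤ) + 1) (by omega)
    have e : N - 1 - (n : ℤ) = N - (n + 1) := by ring
    rw [e] at h2
    rw [h1]
    apply mul_right_cancel₀ h3
    linear_combination (1 - q ^ (N - (↑n + 1))) * ih - (1 - q ^ N) * h2

lemma absorb_top (N n : ℤ) : qbin N n * (1 - q ^ n) = qbin (N - 1) (n - 1) * (1 - q ^ N) := by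
  rcases lt_trichotomy n 0 with h | h | h
  · rw [qbin_neg _ _ h, qbin_neg _ _ (by omega)]; simp
  · subst h; rw [qbin_neg _ (0 - 1) (by omega)]; simp
  · obtain ⟨m, rfl⟩ : ∃ m : ℕ, n = (m : ℤ) + 1 := ⟨(n - 1).toNat, by omega⟩
    rw [absorb_top_nat]
    simp

lemma pascal (N n : ℤ) : qbin N n = qbin (N - 1) n + q ^ (N - n) * qbin (N - 1) (n - 1) := by
  rcases lt_trichotomy n 0 with h | h | h
  · rw [qbin_neg _ _ h, qbin_neg _ _ h, qbin_neg _ _ (by omega)]; simp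
  · subst h; rw [qbin_neg _ (0 - 1) (by omega)]; simp [qbin_zero]
  · have h1 := absorb_top N n
    have h2 := absorb (N - 1) n
    have h3 := one_sub_q_zpow_ne n h
    apply mul_right_cancel₀ h3
    have e : q ^ N = q ^ (N - n) * q ^ n := by rw [← zpow_add₀ q_ne]; congr 1; ring
    have e2 : N - 1 - n + 1 = N - n := by ring
    rw [e2] at h2
    rw [e] at h1
    linear_combination h1 - h2

lemma pascal' (N n : ℤ) : qbin N n = q ^ n * qbin (N - 1) n + qbin (N - 1) (n - 1) := by
  have h1 := pascal N n
  have h2 := absorb (N - 1) n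
  have e2 : N - 1 - n + 1 = N - n := by ring
  rw [e2] at h2
  linear_combination h1 + h2

lemma tri_nat (N s : ℤ) (i : ℕ) :
    qbin N s * qbin (N - s) i = qbin N (s + i) * qbin (s + i) i := by
  induction i with
  | zero => simp [qbin_zero]
  | succ n ih =>
    have h1 := absorb_nat (N - s) n
    have h2 := absorb N (s + n + 1)
    have h3 := absorb_top_nat (s + n + 1) n
    have d1 := one_sub_q_zpow_ne ((n : ℤ) + 1) (by omega)
    have e1 : s + (n : ℤ) + 1 - 1 = s + n := by ring
    have e2 : N - (s + (n : ℤ) + 1) + 1 = N - s - n := by ring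
    rw [e1, e2] at h2
    rw [e1] at h3
    push_cast
    rw [← add_assoc]
    apply mul_right_cancel₀ d1
    linear_combination qbin N s * h1 + (1 - q ^ (N - s - n)) * ih - qbin (s + n) n * h2
      - qbin N (s + n + 1) * h3

lemma tri (L : ℤ) (i j : ℕ) : qbin (L - i) ((j : ℤ) - i) * qbin (L - j) i =
    qbin (L - i) j * qbin j i := by
  by_cases h : j < i
  · rw [qbin_neg _ _ (by omega), qbin_oor (j : ℤ) i (by omega) (by omega)]; simp
  · have := tri_nat (L - i) ((j : ℤ) - i) i
    rw [show L - (i : ℤ) - (j - i) = L - j by ring, show (j : ℤ) - i + i = j by ring] at this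
    exact this

lemma T_pred (m : ℤ) : T m = T (m - 1) + m := by
  unfold T
  have : m * (m + 1) = (m - 1) * (m - 1 + 1) + m * 2 := by ring
  rw [this, Int.add_mul_ediv_right _ _ (by norm_num)]

lemma T_two (m : ℤ) : 2 * T m = m * (m + 1) := by
  unfold T
  exact Int.mul_ediv_cancel' (Int.even_mul_succ_self m).two_dvd

lemma T_zero : T 0 = 0 := by decide

noncomputable def mm (P b α : ℤ) : RatFunc ℚ := qbin (P + b) b * qbin P α

lemma mm_rec (P b α : ℤ) : mm P b α = mm (P - 1) b α + q ^ (P - α) * mm (P - 1) b (α - 1) +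
    q ^ P * mm P (b - 1) α := by
  unfold mm
  have h1 := pascal (P + b) b
  have h2 := pascal P α
  rw [show P + b - b = P by ring] at h1
  rw [show P + (b - 1) = P + b - 1 by ring, show P - 1 + b = P + b - 1 by ring]
  linear_combination qbin P α * h1 + qbin (P + b - 1) b * h2

lemma mm_ne {P b α : ℤ} (h : mm P b α ≠ 0) : 0 ≤ b ∧ 0 ≤ α ∧ (P + b < 0 ∨ α ≤ P) := by
  unfold mm at h
  have h1 := left_ne_zero_of_mul h
  have h2 := right_ne_zero_of_mul h
  have a1 : 0 ≤ b := by by_contra hb; exact h1 (qbin_neg _ _ (by omega))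
  have a2 : 0 ≤ α := by by_contra hb; exact h2 (qbin_neg _ _ (by omega))
  refine ⟨a1, a2, ?_⟩
  by_contra hc
  push Not at hc
  by_cases hP : 0 ≤ P
  · exact h2 (qbin_oor _ _ hP hc.2)
  · exact h1 (qbin_oor _ _ hc.1 (by omega))

lemma qbin_ne {N n : ℤ} (h : qbin N n ≠ 0) : 0 ≤ n ∧ (N < 0 ∨ n ≤ N) := by
  have a1 : 0 ≤ n := by by_contra hb; exact h (qbin_neg _ _ (by omega))
  refine ⟨a1, ?_⟩
  by_contra hc
  push Not at hc
  exact h (qbin_oor _ _ hc.1 hc.2)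

/-- core summand -/
noncomputable def sg (t a b c α β γ A P Q : ℤ) : RatFunc ℚ :=
  q ^ (T t + T α + T β + T (γ - 1)) *
    ((q ^ γ * qbin A a * qbin Q γ + qbin (A - 1) (a - 1) * qbin Q (γ - 1)) *
      mm P b α * mm Q c β)

lemma sg_rec1 (t a b c α β γ A P Q : ℤ) : sg t a b c α β γ A P Q =
    sg t a b c α β γ (A - 1) P Q +
    q ^ (A - a + t) * sg (t - 1) (a - 1) b c α β γ (A - 1) P Q := by
  unfold sg
  have h1 := pascal A a
  have h2 := pascal (A - 1) (a - 1)
  rw [show A - 1 - (a - 1) = A - a by ring] at h2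
  rw [T_pred t, h1, h2]
  simp only [zpow_add₀ q_ne]
  ring

lemma sg_rec2 (t a b c α β γ A P Q : ℤ) : sg t a b c α β γ A P Q =
    sg t a b c α β γ A (P - 1) Q +
    q ^ (P + t) * sg (t - 1) a (b - 1) c α β γ A P Q +
    q ^ (P + t) * sg (t - 1) a b c (α - 1) β γ A (P - 1) Q := by
  unfold sg
  have h1 := mm_rec P b α
  rw [h1, T_pred t, T_pred α]
  have h := q_ne
  have hα : q ^ α ≠ 0 := zpow_ne_zero _ h
  simp only [zpow_add₀ q_ne, zpow_sub₀ q_ne]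
  field_simp
  ring

lemma sg_rec3 (t a b c α β γ A P Q : ℤ) : sg t a b c α β γ A P Q =
    sg t a b c α β γ A P (Q - 1) +
    q ^ (Q + t) * (sg (t - 1) a b c α β (γ - 1) A P (Q - 1) +
      sg (t - 1) a b c α (β - 1) γ A P (Q - 1) +
      sg (t - 1) a b (c - 1) α β γ A P Q) +
    q ^ (2 * (Q + t) - 1) * sg (t - 1 - 1) a b c α (β - 1) (γ - 1) A P (Q - 1) := by
  unfold sg
  have h1 := mm_rec Q c β
  have h2 := pascal Q γ
  have h3 := pascal Q (γ - 1)
  rw [T_pred t, T_pred (t - 1), T_pred β, T_pred (γ - 1)]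
  have h := q_ne
  have hα : q ^ β ≠ 0 := zpow_ne_zero _ h
  have hγ : q ^ γ ≠ 0 := zpow_ne_zero _ h
  simp only [two_mul, zpow_add₀ q_ne, zpow_sub₀ q_ne, zpow_one] at h1 h2 h3 ⊢
  generalize q ^ T (t - 1 - 1) = e1
  generalize q ^ T (β - 1) = e2
  generalize q ^ T (γ - 1 - 1) = e3
  generalize q ^ T α = e4
  rw [h1, mul_add, mul_add, mul_add]
  conv_lhs => 
    enter [1]
    rw [h2, h3]
  field_simp
  ring


/-- summand indexed by integer triples -/
noncomputable def ss (i j k L1 L2 M : ℤ) (v : ℤ × ℤ × ℤ) : RatFunc ℚ :=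
  sg (i + j + k - v.1 - v.2.1 - v.2.2) (i - v.1 - v.2.1) (j - v.1 - v.2.2) (k - v.2.1 - v.2.2)
    v.1 v.2.1 v.2.2
    (L1 - (i + j + k - v.1 - v.2.1 - v.2.2) + (i - v.1 - v.2.1))
    (L2 - (i + j + k - v.1 - v.2.1 - v.2.2)) (M - (i + j + k - v.1 - v.2.1 - v.2.2))

/-- consequences of a core summand being nonzero -/
lemma sg_ne {t a b c α β γ A P Q : ℤ} (h : sg t a b c α β γ A P Q ≠ 0) :
    0 ≤ a ∧ 0 ≤ b ∧ 0 ≤ c ∧ 0 ≤ α ∧ 0 ≤ β ∧ 0 ≤ γ ∧ (P + b < 0 ∨ α ≤ P) ∧ (Q + c < 0 ∨ β ≤ Q) ∧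
    ((Q < 0 ∨ γ ≤ Q) ∧ (A < 0 ∨ a ≤ A) ∨
      1 ≤ a ∧ 1 ≤ γ ∧ (Q < 0 ∨ γ - 1 ≤ Q) ∧ (A - 1 < 0 ∨ a - 1 ≤ A - 1)) := by
  unfold sg at h
  have h1 := right_ne_zero_of_mul h
  have hc := mm_ne (right_ne_zero_of_mul h1)
  have h2 := left_ne_zero_of_mul h1
  have hb := mm_ne (right_ne_zero_of_mul h2)
  have h3 := left_ne_zero_of_mul h2
  by_cases h4 : q ^ γ * qbin A a * qbin Q γ = 0
  · rw [h4, zero_add] at h3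
    have ha := qbin_ne (left_ne_zero_of_mul h3)
    have hg := qbin_ne (right_ne_zero_of_mul h3)
    omega
  · have hg := qbin_ne (right_ne_zero_of_mul h4)
    have ha := qbin_ne (right_ne_zero_of_mul (left_ne_zero_of_mul h4))
    omega

lemma ss_ne {i j k L1 L2 M : ℤ} {v : ℤ × ℤ × ℤ} (h : ss i j k L1 L2 M v ≠ 0) :
    0 ≤ i - v.1 - v.2.1 ∧ 0 ≤ j - v.1 - v.2.2 ∧ 0 ≤ k - v.2.1 - v.2.2 ∧ 0 ≤ v.1 ∧ 0 ≤ v.2.1 ∧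
      0 ≤ v.2.2 := by
  have := sg_ne h
  omega

lemma g_eq_finsum (i j k L1 L2 M : ℤ) : g i j k L1 L2 M = ∑ᶠ v, ss i j k L1 L2 M v := by
  have hR : ∀ (n : ℕ) (f : ℤ → RatFunc ℚ),
      ∑ x ∈ Finset.range (n + 1), f (x : ℤ) = ∑ x ∈ Finset.Icc (0 : ℤ) n, f x := by
    intro n f
    apply Finset.sum_bij (fun (x : ℕ) _ => (x : ℤ))
    · intro a ha; simp at ha ⊢; omega
    · intro a _ b _ h; exact_mod_cast h
    · intro b hb; simp at hb; exact ⟨b.toNat, by simp; omega, by omega⟩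
    · intros; rfl
  rw [finsum_eq_sum_of_support_subset (s := Finset.Icc (0 : ℤ) i.toNat ×ˢ
    (Finset.Icc (0 : ℤ) i.toNat ×ˢ Finset.Icc (0 : ℤ) j.toNat))]
  · rw [Finset.sum_product, ← hR]
    unfold g
    refine Finset.sum_congr rfl fun x _ => ?_
    rw [Finset.sum_product, ← hR]
    refine Finset.sum_congr rfl fun y _ => ?_
    rw [← hR]
    refine Finset.sum_congr rfl fun z _ => ?_
    by_cases hc : (x : ℤ) + y ≤ i ∧ (x : ℤ) + z ≤ j ∧ (y : ℤ) + z ≤ k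
    · rw [if_pos hc]
      simp only [ss, sg, mm]
      have e : i - (x : ℤ) - y + (j - x - z) + (k - y - z) + x + y + z = i + j + k - x - y - z := by
        ring
      rw [e]
      ring
    · rw [if_neg hc]
      by_contra hne
      have := ss_ne (Ne.symm hne)
      simp only at this
      omega
  · intro v hv
    have := ss_ne hv
    simp only [Finset.coe_product, Finset.coe_Icc, Set.mem_prod, Set.mem_Icc]
    omega

lemma ss_fin (i j k L1 L2 M : ℤ) : (Function.support (ss i j k L1 L2 M)).Finite := by
  apply Set.Finite.subset (Finset.finite_toSet (Finset.Icc (0 : ℤ) i ×ˢ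
    (Finset.Icc (0 : ℤ) i ×ˢ Finset.Icc (0 : ℤ) j)))
  intro v hv
  have := ss_ne hv
  simp only [Finset.coe_product, Finset.coe_Icc, Set.mem_prod, Set.mem_Icc]
  omega

/-- translation invariant form -/
lemma g_shift (i j k L1 L2 M : ℤ) (w : ℤ × ℤ × ℤ) :
    g i j k L1 L2 M = ∑ᶠ v, ss i j k L1 L2 M (v - w) := by
  rw [g_eq_finsum]
  exact (finsum_comp_equiv (Equiv.subRight w) (f := ss i j k L1 L2 M)).symm

lemma ss_fin_shift (i j k L1 L2 M : ℤ) (w : ℤ × ℤ × ℤ) :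
    (Function.support (fun v => ss i j k L1 L2 M (v - w))).Finite := by
  have h := ss_fin i j k L1 L2 M
  exact h.preimage (f := fun v => v - w) (Set.injOn_of_injective (sub_left_injective))

lemma fin_mul {f : ℤ × ℤ × ℤ → RatFunc ℚ} (c : RatFunc ℚ) (h : (Function.support f).Finite) :
    (Function.support (fun v => c * f v)).Finite :=
  h.subset (fun _ hv => right_ne_zero_of_mul hv)

lemma fin_add {f g : ℤ × ℤ × ℤ → RatFunc ℚ} (hf : (Function.support f).Finite)
    (hg : (Function.support g).Finite) : (Function.support (fun v => f v + g v)).Finite :=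
  (hf.union hg).subset (Function.support_add f g)

lemma finsum_mul_l {f : ℤ × ℤ × ℤ → RatFunc ℚ} (c : RatFunc ℚ) (_ : (Function.support f).Finite) :
    ∑ᶠ v, c * f v = c * ∑ᶠ v, f v := (mul_finsum f c).symm

lemma g_rec1 (i j k L1 L2 M : ℤ) : g i j k L1 L2 M = g i j k (L1 - 1) L2 M +
    q ^ L1 * g (i - 1) j k (L1 - 1) (L2 - 1) (M - 1) := by
  simp only [g_eq_finsum]
  rw [← finsum_mul_l _ (ss_fin _ _ _ _ _ _), ← finsum_add_distrib (ss_fin _ _ _ _ _ _)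
    (fin_mul _ (ss_fin _ _ _ _ _ _))]
  refine finsum_congr fun v => ?_
  unfold ss
  rw [sg_rec1]
  ring_nf

lemma g_rec2 (i j k L1 L2 M : ℤ) : g i j k L1 L2 M = g i j k L1 (L2 - 1) M +
    q ^ L2 * g i (j - 1) k (L1 - 1) (L2 - 1) (M - 1) +
    q ^ L2 * g (i - 1) (j - 1) k (L1 - 1) (L2 - 2) (M - 1) := by
  rw [g_shift (i - 1) _ _ _ _ _ (1, 0, 0)]
  simp only [g_eq_finsum]
  rw [← finsum_mul_l _ (ss_fin _ _ _ _ _ _), ← finsum_mul_l _ (ss_fin_shift _ _ _ _ _ _ _),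
    ← finsum_add_distrib (ss_fin _ _ _ _ _ _) (fin_mul _ (ss_fin _ _ _ _ _ _)),
    ← finsum_add_distrib (fin_add (ss_fin _ _ _ _ _ _) (fin_mul _ (ss_fin _ _ _ _ _ _)))
      (fin_mul _ (ss_fin_shift _ _ _ _ _ _ _))]
  refine finsum_congr fun v => ?_
  unfold ss
  rw [sg_rec2]
  simp only [Prod.fst_sub, Prod.snd_sub]
  ring_nf

lemma g_rec3 (i j k L1 L2 M : ℤ) : g i j k L1 L2 M = g i j k L1 L2 (M - 1) +
    q ^ M * (g i (j - 1) (k - 1) (L1 - 1) (L2 - 1) (M - 2) +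
      g (i - 1) j (k - 1) (L1 - 1) (L2 - 1) (M - 2) +
      g i j (k - 1) (L1 - 1) (L2 - 1) (M - 1)) +
    q ^ (2 * M - 1) * g (i - 1) (j - 1) (k - 2) (L1 - 2) (L2 - 2) (M - 3) := by
  rw [g_shift (i - 1) (j - 1) _ _ _ _ (0, 1, 1), g_shift i (j - 1) _ _ _ _ (0, 0, 1),
    g_shift (i - 1) j _ _ _ _ (0, 1, 0)]
  simp only [g_eq_finsum]
  have f0 := ss_fin_shift
  have f1 := ss_fin
  rw [← finsum_add_distrib (f0 _ _ _ _ _ _ _) (f0 _ _ _ _ _ _ _),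
    ← finsum_add_distrib (fin_add (f0 _ _ _ _ _ _ _) (f0 _ _ _ _ _ _ _)) (f1 _ _ _ _ _ _),
    ← finsum_mul_l _ (fin_add (fin_add (f0 _ _ _ _ _ _ _) (f0 _ _ _ _ _ _ _)) (f1 _ _ _ _ _ _)),
    ← finsum_mul_l _ (f0 _ _ _ _ _ _ _),
    ← finsum_add_distrib (f1 _ _ _ _ _ _) (fin_mul _
      (fin_add (fin_add (f0 _ _ _ _ _ _ _) (f0 _ _ _ _ _ _ _)) (f1 _ _ _ _ _ _))),
    ← finsum_add_distrib (fin_add (f1 _ _ _ _ _ _) (fin_mul _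
      (fin_add (fin_add (f0 _ _ _ _ _ _ _) (f0 _ _ _ _ _ _ _)) (f1 _ _ _ _ _ _))))
      (fin_mul _ (f0 _ _ _ _ _ _ _))]
  refine finsum_congr fun v => ?_
  unfold ss
  rw [sg_rec3]
  simp only [Prod.fst_sub, Prod.snd_sub]
  ring_nf

/-- the boundary sum -/
noncomputable def ff (i j k L M : ℤ) : RatFunc ℚ := g i j k (i - 1) L M

lemma g_low (i j k L M : ℤ) : g i j k (i - 2) L M =
    ff i j k L M - q ^ (i - 1) * ff (i - 1) j k (L - 1) (M - 1) := by
  have := g_rec1 i j k (i - 1) L M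
  unfold ff
  rw [show i - 1 - 1 = i - 2 by ring] at *
  rw [this]; ring

lemma ff_rec2 (i j k L M : ℤ) : ff i j k L M = ff i j k (L - 1) M +
    q ^ L * (ff i (j - 1) k (L - 1) (M - 1) - q ^ (i - 1) * ff (i - 1) (j - 1) k (L - 2) (M - 2)) +
    q ^ L * ff (i - 1) (j - 1) k (L - 2) (M - 1) := by
  have h := g_rec2 i j k (i - 1) L M
  have h1 := g_low i (j - 1) k (L - 1) (M - 1)
  rw [show i - 1 - 1 = i - 2 by ring, h1] at h
  simp only [show L - 1 - 1 = L - 2 by ring, show M - 1 - 1 = M - 2 by ring] at h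
  rw [show i - 2 = i - 1 - 1 by ring] at h
  exact h

lemma ff_rec3 (i j k L M : ℤ) : ff i j k L M = ff i j k L (M - 1) +
    q ^ M * (ff i (j - 1) (k - 1) (L - 1) (M - 2)
        - q ^ (i - 1) * ff (i - 1) (j - 1) (k - 1) (L - 2) (M - 3) +
      ff (i - 1) j (k - 1) (L - 1) (M - 2) +
      (ff i j (k - 1) (L - 1) (M - 1) - q ^ (i - 1) * ff (i - 1) j (k - 1) (L - 2) (M - 2))) +
    q ^ (2 * M - 1) * (ff (i - 1) (j - 1) (k - 2) (L - 2) (M - 3)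
      - q ^ (i - 2) * ff (i - 2) (j - 1) (k - 2) (L - 3) (M - 4)) := by
  have h := g_rec3 i j k (i - 1) L M
  have h1 := g_low i (j - 1) (k - 1) (L - 1) (M - 2)
  have h2 := g_low i j (k - 1) (L - 1) (M - 1)
  have h3 := g_low (i - 1) (j - 1) (k - 2) (L - 2) (M - 3)
  rw [show i - 1 - 2 = i - 3 by ring] at h3 h
  rw [show i - 1 - 1 = i - 2 by ring] at h h3
  rw [h1, h2, h3] at h
  simp only [show L - 1 - 1 = L - 2 by ring, show M - 1 - 1 = M - 2 by ring,
    show M - 2 - 1 = M - 3 by ring, show L - 2 - 1 = L - 3 by ring,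
    show M - 3 - 1 = M - 4 by ring] at h
  rw [show g (i - 1) j (k - 1) (i - 2) (L - 1) (M - 2) = ff (i - 1) j (k - 1) (L - 1) (M - 2) by
    unfold ff; congr 1; ring] at h
  exact h

/-- the closed form -/
noncomputable def cf (i j k L M : ℤ) : RatFunc ℚ :=
  q ^ (i * (M + 2) - T i + T (j - i) + T (k - i)) *
    (qbin (L - i) j * qbin j i * qbin (M - i - j) (k - i))

/-- exponent helper -/
lemma cf_eq (i j k L M : ℤ) (E A B C D F : ℤ)
    (hE : i * (M + 2) - T i + T (j - i) + T (k - i) = E)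
    (hA : L - i = A) (hB : j = B) (hC : i = C) (hD : M - i - j = D) (hF : k - i = F) :
    cf i j k L M = q ^ E * (qbin A B * qbin B C * qbin D F) := by
  subst hE hA hB hC hD hF; rfl

lemma cf_rec2 (i j k L M : ℤ) : cf i j k L M = cf i j k (L - 1) M +
    q ^ L * (cf i (j - 1) k (L - 1) (M - 1) - q ^ (i - 1) * cf (i - 1) (j - 1) k (L - 2) (M - 2)) +
    q ^ L * cf (i - 1) (j - 1) k (L - 2) (M - 1) := by
  obtain ⟨E, hE⟩ : ∃ E, i * (M + 2) - T i + T (j - i) + T (k - i) = E := ⟨_, rfl⟩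
  have t1 := T_pred i
  have t2 := T_pred (j - i)
  have t3 := T_pred (k - i + 1)
  rw [show j - i - 1 = j - 1 - i by ring] at t2
  rw [show k - i + 1 - 1 = k - i by ring, show k - i + 1 = k - (i - 1) by ring] at t3
  have t4 : j - 1 - (i - 1) = j - i := by ring
  rw [cf_eq i j k L M E (L - i) j i (M - i - j) (k - i) hE rfl rfl rfl rfl rfl,
    cf_eq i j k (L - 1) M E (L - i - 1) j i (M - i - j) (k - i) hE (by ring) rfl rfl rfl rfl,
    cf_eq i (j - 1) k (L - 1) (M - 1) (E - j) (L - i - 1) (j - 1) i (M - i - j) (k - i)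
      (by linarith) (by ring) rfl rfl (by ring) rfl,
    cf_eq (i - 1) (j - 1) k (L - 2) (M - 2) (E - M - 2 * i + k + 1) (L - i - 1) (j - 1) (i - 1)
      (M - i - j) (k - i + 1)
      (by rw [t4]; linarith) (by ring) rfl rfl (by ring) (by ring),
    cf_eq (i - 1) (j - 1) k (L - 2) (M - 1) (E - M - i + k) (L - i - 1) (j - 1) (i - 1)
      (M - i - j + 1) (k - i + 1)
      (by rw [t4]; linarith) (by ring) rfl rfl (by ring) (by ring)]
  have p1 := pascal (L - i) j
  have p2 := pascal' j i
  have p3 := pascal (M - i - j + 1) (k - i + 1)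
  rw [show M - i - j + 1 - 1 = M - i - j by ring, show k - i + 1 - 1 = k - i by ring,
    show M - i - j + 1 - (k - i + 1) = M - j - k by ring] at p3
  rw [p1, p3, p2]
  have h := q_ne
  have h1 : q ^ i ≠ 0 := zpow_ne_zero _ h
  have h2 : q ^ j ≠ 0 := zpow_ne_zero _ h
  have h3 : q ^ k ≠ 0 := zpow_ne_zero _ h
  have h4 : q ^ M ≠ 0 := zpow_ne_zero _ h
  simp only [two_mul, zpow_add₀ q_ne, zpow_sub₀ q_ne, zpow_one]
  field_simp
  ring

lemma cf_rec3 (i j k L M : ℤ) : cf i j k L M = cf i j k L (M - 1) +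
    q ^ M * (cf i (j - 1) (k - 1) (L - 1) (M - 2)
        - q ^ (i - 1) * cf (i - 1) (j - 1) (k - 1) (L - 2) (M - 3) +
      cf (i - 1) j (k - 1) (L - 1) (M - 2) +
      (cf i j (k - 1) (L - 1) (M - 1) - q ^ (i - 1) * cf (i - 1) j (k - 1) (L - 2) (M - 2))) +
    q ^ (2 * M - 1) * (cf (i - 1) (j - 1) (k - 2) (L - 2) (M - 3)
      - q ^ (i - 2) * cf (i - 2) (j - 1) (k - 2) (L - 3) (M - 4)) := by
  obtain ⟨E, hE⟩ : ∃ E, i * (M + 2) - T i + T (j - i) + T (k - i) = E := ⟨_, rfl⟩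
  have t1 := T_pred i
  have t1' := T_pred (i - 1)
  have t2 := T_pred (j - i)
  have t2' := T_pred (j - i + 1)
  have t3 := T_pred (k - i)
  rw [show i - 1 - 1 = i - 2 by ring] at t1'
  rw [show j - i - 1 = j - 1 - i by ring] at t2
  rw [show j - i + 1 - 1 = j - i by ring] at t2'
  rw [show k - i - 1 = k - 1 - i by ring] at t3
  have u1 : j - 1 - (i - 1) = j - i := by ring
  have u2 : k - 1 - (i - 1) = k - i := by ring
  have u3 : j - (i - 1) = j - i + 1 := by ring
  have u4 : k - 2 - (i - 1) = k - 1 - i := by ring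
  have u5 : j - 1 - (i - 2) = j - i + 1 := by ring
  have u6 : k - 2 - (i - 2) = k - i := by ring
  rw [cf_eq i j k L M E (L - i) j i (M - i - j) (k - i) hE rfl rfl rfl rfl rfl,
    cf_eq i j k L (M - 1) (E - i) (L - i) j i (M - i - j - 1) (k - i)
      (by linarith) (by ring) rfl rfl (by ring) rfl,
    cf_eq i (j - 1) (k - 1) (L - 1) (M - 2) (E - j - k) (L - i - 1) (j - 1) i
      (M - i - j - 1) (k - i - 1) (by linarith) (by ring) rfl rfl (by ring) (by ring),
    cf_eq (i - 1) (j - 1) (k - 1) (L - 2) (M - 3) (E - 2 * i - M + 1) (L - i - 1) (j - 1) (i - 1)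
      (M - i - j - 1) (k - i) (by rw [u1, u2]; linarith) (by ring) rfl rfl (by ring) (by ring),
    cf_eq (i - 1) j (k - 1) (L - 1) (M - 2) (E - M - 2 * i + j + 1) (L - i) j (i - 1)
      (M - i - j - 1) (k - i) (by rw [u3, u2]; linarith) (by ring) rfl rfl (by ring) (by ring),
    cf_eq i j (k - 1) (L - 1) (M - 1) (E - k) (L - i - 1) j i
      (M - i - j - 1) (k - i - 1) (by linarith) (by ring) rfl rfl (by ring) (by ring),
    cf_eq (i - 1) j (k - 1) (L - 2) (M - 2) (E - M - 2 * i + j + 1) (L - i - 1) j (i - 1)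
      (M - i - j - 1) (k - i) (by rw [u3, u2]; linarith) (by ring) rfl rfl (by ring) (by ring),
    cf_eq (i - 1) (j - 1) (k - 2) (L - 2) (M - 3) (E - M - i + 1 - k) (L - i - 1) (j - 1) (i - 1)
      (M - i - j - 1) (k - i - 1) (by rw [u1, u4]; linarith) (by ring) rfl rfl (by ring) (by ring),
    cf_eq (i - 2) (j - 1) (k - 2) (L - 3) (M - 4) (E - 2 * M - 3 * i + 4 + j) (L - i - 1) (j - 1)
      (i - 1 - 1) (M - i - j - 1) (k - i) (by rw [u5, u6]; linarith) (by ring) rfl (by ring)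
      (by ring) (by ring)]
  have p1 := pascal' (L - i) j
  have p2 := pascal j i
  have p2' := pascal j (i - 1)
  have p3 := pascal (M - i - j) (k - i)
  have p4 := absorb j i
  rw [show M - i - j - (k - i) = M - j - k by ring] at p3
  have h := q_ne
  have h1 : q ^ i ≠ 0 := zpow_ne_zero _ h
  have h2 : q ^ j ≠ 0 := zpow_ne_zero _ h
  have h3 : q ^ k ≠ 0 := zpow_ne_zero _ h
  have h4 : q ^ M ≠ 0 := zpow_ne_zero _ h
  simp only [show (3 : ℤ) * i = i + i + i by ring, show (4 : ℤ) = 1 + 1 + 1 + 1 by norm_num,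
    show (2 : ℤ) = 1 + 1 by norm_num, add_mul, one_mul] at *
  simp only [zpow_add₀ q_ne, zpow_sub₀ q_ne, zpow_one] at p1 p2 p2' p3 p4 ⊢
  generalize qbin (L - i) j = X at *
  generalize qbin (L - i - 1) j = X1 at *
  generalize qbin (L - i - 1) (j - 1) = X0 at *
  generalize qbin j i = Y at *
  generalize qbin j (i - 1) = Y' at *
  generalize qbin (j - 1) i = y0 at *
  generalize qbin (j - 1) (i - 1) = y1 at *
  generalize qbin (j - 1) (i - 1 - 1) = y2 at *
  generalize qbin (M - i - j) (k - i) = Z at *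
  generalize qbin (M - i - j - 1) (k - i) = A at *
  generalize qbin (M - i - j - 1) (k - i - 1) = B at *
  generalize q ^ E = e at *
  generalize q ^ i = I at *
  generalize q ^ j = J at *
  generalize q ^ k = K at *
  generalize q ^ M = m at *
  clear t1 t1' t2 t2' t3 u1 u2 u3 u4 u5 u6 hE
  have r1 : y0 = Y - J / I * y1 := by rw [p2]; ring
  have r2 : y1 = Y' - J / (I / q) * y2 := by rw [p2']; ring
  have r3 : Y = I * Y + Y' * (1 - J / I * q) := by linear_combination p4
  rw [p3, r1, p1]
  field_simp
  field_simp at p2' r3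
  linear_combination (e * J * K * A) * (-X * r3 - X0 * p2') + (e * J * K * A * (I * Y - I ^ 2 * Y - Y' * (I - J * q))) * p1


lemma qbin_self (n : ℤ) (h : 0 ≤ n) : qbin n n = 1 := by
  obtain ⟨m, rfl⟩ : ∃ m : ℕ, n = m := ⟨n.toNat, by omega⟩
  have := tri_nat (m : ℤ) 0 m
  simp only [qbin_zero, zero_add, sub_zero, one_mul] at this
  clear this
  induction m with
  | zero => simp [qbin_zero]
  | succ m ih =>
    have h1 := pascal ((m : ℤ) + 1) (m + 1)
    push_cast
    rw [h1, qbin_oor _ _ (by omega) (by omega)]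
    simp only [add_sub_cancel_right, sub_self, zpow_zero, zero_add, one_mul]
    exact ih (by omega)

lemma ff_neg (i j k L M : ℤ) (h : i < 0 ∨ j < 0 ∨ k < 0) : ff i j k L M = 0 := by
  unfold ff
  rw [g_eq_finsum]
  apply finsum_eq_zero_of_forall_eq_zero
  intro v
  by_contra hv
  have := ss_ne hv
  omega

lemma cf_neg (i j k L M : ℤ) (h : i < 0 ∨ j < 0 ∨ k < 0) : cf i j k L M = 0 := by
  by_contra hv
  unfold cf at hv
  have h1 := right_ne_zero_of_mul hv
  have h2 := qbin_ne (right_ne_zero_of_mul h1)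
  have h3 := left_ne_zero_of_mul h1
  have h4 := qbin_ne (left_ne_zero_of_mul h3)
  have h5 := qbin_ne (right_ne_zero_of_mul h3)
  omega

lemma base_zero (i j k : ℤ) (hi : 0 ≤ i) (hj : 0 ≤ j) (hk : 0 ≤ k)
    (h : j ≠ k ∨ i < j) : ff i j k (i + k) (i + j) = cf i j k (i + k) (i + j) := by
  have h1 : ff i j k (i + k) (i + j) = 0 := by
    unfold ff
    rw [g_eq_finsum]
    apply finsum_eq_zero_of_forall_eq_zero
    intro v
    by_contra hv
    have := sg_ne hv
    omega
  have h2 : cf i j k (i + k) (i + j) = 0 := by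
    by_contra hv
    unfold cf at hv
    have h1 := right_ne_zero_of_mul hv
    have h2 := qbin_ne (right_ne_zero_of_mul h1)
    have h3 := left_ne_zero_of_mul h1
    have h4 := qbin_ne (left_ne_zero_of_mul h3)
    have h5 := qbin_ne (right_ne_zero_of_mul h3)
    omega
  rw [h1, h2]

lemma base_eq (i : ℤ) (hi : 0 ≤ i) : ff i i i (i + i) (i + i) = cf i i i (i + i) (i + i) := by
  have h1 : ff i i i (i + i) (i + i) =
      ss i i i (i - 1) (i + i) (i + i) (i / 2, i / 2, i - i / 2) := by
    unfold ff
    rw [g_eq_finsum]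
    apply finsum_eq_single
    intro v hv
    by_contra hne
    have := sg_ne hne
    apply hv
    ext <;> simp only <;> omega
  have h2 : cf i i i (i + i) (i + i) = q ^ (i * (i + i + 2) - T i) := by
    unfold cf
    simp only [sub_self, T_zero, add_zero, add_sub_cancel_right, qbin_zero, qbin_self i hi, mul_one]
  rw [h1, h2]
  obtain ⟨α, rfl | rfl⟩ := Int.even_or_odd' i
  · have e : 2 * α / 2 = α := by omega
    simp only [ss, e]
    ring_nf
    simp only [sg, mm, qbin_zero, zero_sub, qbin_self α (by omega), qbin_neg _ (-1) (by omega),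
      add_zero, mul_one, zero_mul]
    rw [← zpow_add₀ q_ne]
    congr 1
    have := T_two (α * 3)
    have := T_two (α * 2)
    have := T_two α
    have := T_pred α
    linarith
  · have e : (2 * α + 1) / 2 = α := by omega
    simp only [ss, e]
    ring_nf
    simp only [sg, mm, qbin_zero, qbin_self α (by omega), sub_self, add_sub_cancel_left,
      add_zero, mul_one, zero_mul, qbin_oor α (1 + α) (by omega) (by omega), mul_zero, zero_add]
    congr 1
    have := T_two (2 + α * 3)
    have := T_two (1 + α * 2)
    have := T_two α
    linarith

lemma qbin_neg_one (k : ℕ) : q ^ T ((k : ℤ) + 1) * qbin (-1) ((k : ℤ) + 1) +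
    q ^ T (k : ℤ) * qbin (-1) k = 0 := by
  have h := absorb_nat (-1) k
  have d := one_sub_q_zpow_ne ((k : ℤ) + 1) (by omega)
  have t := T_pred ((k : ℤ) + 1)
  rw [add_sub_cancel_right] at t
  rw [t, zpow_add₀ q_ne]
  apply mul_right_cancel₀ d
  have e : q ^ (-1 - (k : ℤ)) * q ^ ((k : ℤ) + 1) = 1 := by
    rw [← zpow_add₀ q_ne]; ring_nf; simp
  linear_combination q ^ T (k : ℤ) * q ^ ((k : ℤ) + 1) * h - q ^ T (k : ℤ) * qbin (-1) k * e

lemma base_low (i k : ℤ) (hk : 0 ≤ k) (h : k < i) :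
    ff i k k (i + k - 1) (i + k) = cf i k k (i + k - 1) (i + k) := by
  have h2 : cf i k k (i + k - 1) (i + k) = 0 := by
    unfold cf
    rw [qbin_oor k i hk h]; simp
  rw [h2]
  have h1 : ff i k k (i + k - 1) (i + k) =
      ss i k k (i - 1) (i + k - 1) (i + k) (k, 0, 0) +
      ss i k k (i - 1) (i + k - 1) (i + k) (k - 1, 0, 1) := by
    unfold ff
    rw [g_eq_finsum, finsum_eq_sum_of_support_subset (s := {(k, 0, 0), (k - 1, 0, 1)})]
    · rw [Finset.sum_pair]
      simp
    · intro v hv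
      have := sg_ne hv
      simp only [Finset.coe_insert, Finset.coe_singleton, Set.mem_insert_iff,
        Set.mem_singleton_iff, Prod.ext_iff]
      omega
  rw [h1]
  rcases eq_or_lt_of_le hk with h0 | h0
  · subst h0
    have z1 : ss i 0 0 (i - 1) (i + 0 - 1) (i + 0) (0, 0, 0) = 0 := by
      by_contra hne
      have := sg_ne hne
      simp only at this
      omega
    have z2 : ss i 0 0 (i - 1) (i + 0 - 1) (i + 0) (0 - 1, 0, 1) = 0 := by
      by_contra hne
      have := sg_ne hne
      simp only at this
      omega
    rw [z1, z2, add_zero]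
  · obtain ⟨m, rfl⟩ : ∃ m : ℕ, k = (m : ℤ) + 1 := ⟨(k - 1).toNat, by omega⟩
    have h3 := qbin_neg_one m
    simp only [ss]
    ring_nf
    ring_nf at h3
    simp only [sg, mm, T_zero, qbin_zero, sub_self, zero_sub, zero_add, add_zero, mul_one,
      qbin_self (m : ℤ) (by omega), qbin_self (1 + (m : ℤ)) (by omega),
      qbin_neg _ (-1) (by omega), qbin_oor 0 1 (by omega) (by omega), zpow_zero, mul_zero, one_mul]
    rw [show T (-1) = 0 by decide]
    simp only [zpow_add₀ q_ne, zpow_zero, mul_one]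
    ring_nf
    linear_combination (q ^ T (1 + i + (m : ℤ)) * qbin (-3 + i - (m : ℤ) * 2) (-1 + i - (m : ℤ))) * h3

lemma const_of_step (D : ℤ → RatFunc ℚ) (h : ∀ x, D x = D (x - 1)) (x : ℤ) : D x = D 0 := by
  induction x using Int.induction_on with
  | zero => rfl
  | succ n ih => rw [h, add_sub_cancel_right, ih]
  | pred n ih => rw [← h, ih]

lemma main_ind (n : ℕ) : ∀ i j k L M : ℤ, j + k < n → ff i j k L M = cf i j k L M := by
  induction n with
  | zero =>
    intro i j k L M h
    have : i < 0 ∨ j < 0 ∨ k < 0 := by push_cast at h; omega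
    rw [ff_neg _ _ _ _ _ this, cf_neg _ _ _ _ _ this]
  | succ n ih =>
    intro i j k L M h
    push_cast at h
    by_cases hneg : i < 0 ∨ j < 0 ∨ k < 0
    · rw [ff_neg _ _ _ _ _ hneg, cf_neg _ _ _ _ _ hneg]
    push Not at hneg
    obtain ⟨hi, hj, hk⟩ := hneg
    have step2 : ∀ L M, ff i j k L M - cf i j k L M = ff i j k (L - 1) M - cf i j k (L - 1) M := by
      intro L M
      rw [ff_rec2, cf_rec2]
      rw [ih i (j - 1) k _ _ (by omega), ih (i - 1) (j - 1) k _ _ (by omega),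
        ih (i - 1) (j - 1) k _ _ (by omega)]
      ring
    have step3 : ∀ L M, ff i j k L M - cf i j k L M = ff i j k L (M - 1) - cf i j k L (M - 1) := by
      intro L M
      rw [ff_rec3, cf_rec3]
      rw [ih i (j - 1) (k - 1) _ _ (by omega), ih (i - 1) (j - 1) (k - 1) _ _ (by omega),
        ih (i - 1) j (k - 1) _ _ (by omega), ih i j (k - 1) _ _ (by omega),
        ih (i - 1) j (k - 1) _ _ (by omega), ih (i - 1) (j - 1) (k - 2) _ _ (by omega),
        ih (i - 2) (j - 1) (k - 2) _ _ (by omega)]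
      ring
    have c2 : ∀ L M, ff i j k L M - cf i j k L M = ff i j k 0 M - cf i j k 0 M := fun L M =>
      const_of_step (fun L => ff i j k L M - cf i j k L M) (fun L => step2 L M) L
    have c3 : ∀ L M, ff i j k L M - cf i j k L M = ff i j k L 0 - cf i j k L 0 := fun L M =>
      const_of_step (fun M => ff i j k L M - cf i j k L M) (fun M => step3 L M) M
    have key : ∃ L M, ff i j k L M - cf i j k L M = 0 := by
      by_cases hc : j ≠ k ∨ i < j
      · exact ⟨_, _, sub_eq_zero.mpr (base_zero i j k hi hj hk hc)⟩
      · push Not at hc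
        obtain ⟨rfl, hc⟩ := hc
        rcases eq_or_lt_of_le hc with he | hl
        · subst he
          exact ⟨_, _, sub_eq_zero.mpr (base_eq j hi)⟩
        · exact ⟨_, _, sub_eq_zero.mpr (base_low i j hj hl)⟩
    obtain ⟨L0, M0, h0⟩ := key
    rw [c2, c3] at h0
    have := c2 L M
    rw [c3, c3 0 M, h0] at this
    have h5 := c3 L M
    rw [this] at h5
    exact sub_eq_zero.mp h5

end BR

/-- Boundary evaluation at `L1 = i - 1`. -/
theorem g_boundary_evaluation (i j k : ℕ) (L2 M : ℤ) :
    g i j k ((i : ℤ) - 1) L2 M =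
      q ^ ((i : ℤ) * (M + 2) - T i + T ((j : ℤ) - i) + T ((k : ℤ) - i)) *
        qbin (L2 - i) ((j : ℤ) - i) * qbin (L2 - j) i * qbin (M - i - j) ((k : ℤ) - i) := by
  have h := BR.main_ind (j + k + 1) i j k L2 M (by push_cast; omega)
  unfold BR.ff BR.cf at h
  rw [h, ← BR.tri]
  ring
end
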